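/- Sufficiency part of the scaling theorem for the multiplicative kernel: Let ν₀ be a positive Radon measure on (0,∞) with ∫ x² ν₀(dx) = 1, let (ν_t)_{0≤t<1} be the solution of Smoluchowski's coagulation equation with kernel K=xy, and set V(t,x) = (∫₀^x y² ν_t(dy)) / (∫₀^∞ y² ν_t(dy)). Suppose there exist ρ ∈ (0,1] and a function L slowly varying at infinity such that ∫₀^x y³ ν₀(dy) ~ x^{1−ρ} L(x) as x → ∞. Then there is a strictly increasing rescaling λ(t) → ∞ as t → 1⁻ such that lim_{t→1⁻} V(t, λ(t)x) = V_ρ(x) for all x ∈ [0,∞), where V_ρ = M_ρ, the second-moment distribution function of the self-similar solution with parameter ρ. -/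

import Mathlib

/-!
Sufficiency part of the scaling theorem for Smoluchowski's coagulation equation
with multiplicative kernel K = xy: attraction to self-similar form at gelation.
-/

open MeasureTheory Filter Topology Set Real

noncomputable section

/-- The self-similar second-moment distribution function for the multiplicative
kernel (equal to the mass distribution M_ρ of the additive kernel), with
β = ρ/(1+ρ):
`V_ρ(x) = M_ρ(x) = Σ_{k=1}^∞ (−1)^{k−1} (x^{kβ}/k!) Γ(1+k−kβ) sin(πkβ)/(πkβ)`. -/
def multSelfSimilarCDF (ρ x : ℝ) : ℝ :=
  ∑' k : ℕ,
    (-1 : ℝ) ^ k * x ^ (((k : ℝ) + 1) * (ρ / (1 + ρ))) / (Nat.factorial (k + 1)) *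
      Real.Gamma (1 + ((k : ℝ) + 1) - ((k : ℝ) + 1) * (ρ / (1 + ρ))) *
      (Real.sin (Real.pi * ((k : ℝ) + 1) * (ρ / (1 + ρ))) /
        (Real.pi * ((k : ℝ) + 1) * (ρ / (1 + ρ))))

/-- generalized binomial coefficient `binom (kβ-1) k`. -/
def lagA (β : ℝ) (k : ℕ) : ℝ := (ascPochhammer ℝ k).eval (k * β - k) / k.factorial

/-- rising binomial coefficient -/
def risB (a : ℝ) (m : ℕ) : ℝ := (ascPochhammer ℝ m).eval a / m.factorial

lemma asc_nonneg (a : ℝ) (ha : 0 ≤ a) (m : ℕ) : 0 ≤ (ascPochhammer ℝ m).eval a := by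
  induction m with
  | zero => simp
  | succ n ih =>
    rw [ascPochhammer_succ_eval]
    positivity

lemma risB_nonneg (a : ℝ) (ha : 0 ≤ a) (m : ℕ) : 0 ≤ risB a m :=
  div_nonneg (asc_nonneg a ha m) (by positivity)

lemma abs_asc_le (a K : ℝ) (m : ℕ) (h : ∀ i < m, |a + i| ≤ K) :
    |(ascPochhammer ℝ m).eval a| ≤ K ^ m := by
  induction m with
  | zero => simp
  | succ n ih =>
    rw [ascPochhammer_succ_eval, abs_mul, pow_succ]
    have h1 := ih (fun i hi => h i (by omega))
    have h2 := h n (by omega)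
    have : 0 ≤ K := le_trans (abs_nonneg _) h2
    gcongr

lemma abs_lagA_le (β : ℝ) (h0 : 0 ≤ β) (h1 : β ≤ 1) (k : ℕ) : |lagA β k| ≤ Real.exp 1 ^ k := by
  unfold lagA
  rw [abs_div, abs_of_pos (by positivity : (0:ℝ) < k.factorial)]
  have : |(ascPochhammer ℝ k).eval (k * β - k)| ≤ (k:ℝ) ^ k := by
    apply abs_asc_le
    intro i hi
    have hi' : (i:ℝ) < k := by exact_mod_cast hi
    have hi0 : (0:ℝ) ≤ i := by positivity
    have : (k:ℝ) * β ≤ k := by nlinarith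
    have : 0 ≤ (k:ℝ) * β := by positivity
    rw [abs_le]
    constructor <;> linarith
  calc _ ≤ (k:ℝ)^k / k.factorial := by gcongr
    _ ≤ Real.exp k := Real.pow_div_factorial_le_exp _ (by positivity) _
    _ = _ := by rw [← Real.exp_nat_mul]; simp

lemma risB_hasSum (a x : ℝ) (hx : |x| < 1) :
    HasSum (fun m => risB a m * x ^ m) ((1 - x) ^ (-a)) := by
  have := (Real.one_div_one_sub_rpow_hasFPowerSeriesOnBall_zero a).hasSum (y := x) (by
    simpa [enorm_eq_nnnorm, ← NNReal.coe_lt_coe] using hx)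
  simp only [FormalMultilinearSeries.ofScalars_apply_eq] at this
  have h2 : 1 / (1 - (0 + x)) ^ a = (1 - x) ^ (-a) := by
    have := abs_lt.mp hx
    rw [Real.rpow_neg (by linarith)]; simp
  rw [h2] at this
  convert! this using 2 with m
  rw [smul_eq_mul]
  congr 1
  have h3 := Ring.descPochhammer_eq_factorial_smul_choose (a + m - 1) m
  rw [Polynomial.descPochhammer_smeval_eq_ascPochhammer, Polynomial.ascPochhammer_smeval_eq_eval] at h3
  unfold risB
  rw [div_eq_iff (by positivity)]
  have : a + m - 1 - m + 1 = a := by ring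
  rw [this] at h3
  rw [h3]; simp [mul_comm]

lemma lagA_mul_risB (β : ℝ) (k m : ℕ) :
    lagA β k * risB (k * β) m = (ascPochhammer ℝ (k + m)).eval (k * (β - 1)) / (k.factorial * m.factorial) := by
  unfold lagA risB
  rw [← ascPochhammer_mul, Polynomial.eval_mul, Polynomial.eval_comp]
  simp only [Polynomial.eval_add, Polynomial.eval_X, Polynomial.eval_natCast]
  rw [div_mul_div_comm]
  congr 3 <;> ring_nf

lemma sum_lag (β : ℝ) (hβ : β ≠ 1) (n : ℕ) :
    ∑ p ∈ Finset.HasAntidiagonal.antidiagonal n, lagA β p.1 * (risB (p.1 * β) p.2 * (-1) ^ p.2) = (β - 1) ^ n := by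
  have hc : β - 1 ≠ 0 := sub_ne_zero.mpr hβ
  set P : Polynomial ℝ := (ascPochhammer ℝ n).comp (Polynomial.C (β - 1) * Polynomial.X) with hP
  have hd : P.natDegree = n := by
    rw [hP, Polynomial.natDegree_comp, ascPochhammer_natDegree, Polynomial.natDegree_C_mul_X _ hc, mul_one]
  have hl : P.leadingCoeff = (β - 1) ^ n := by
    rw [hP, Polynomial.leadingCoeff_comp (by rw [Polynomial.natDegree_C_mul_X _ hc]; simp),
      (monic_ascPochhammer ℝ n).leadingCoeff, ascPochhammer_natDegree, Polynomial.leadingCoeff_C_mul_X, one_mul]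
  have h := congrFun (Polynomial.fwdDiff_iter_degree_eq_factorial P) 0
  rw [hd, hl, fwdDiff_iter_eq_sum_shift] at h
  rw [Finset.Nat.sum_antidiagonal_eq_sum_range_succ_mk]
  have hf : (n.factorial : ℝ) ≠ 0 := by positivity
  apply mul_right_cancel₀ hf
  simp only [Pi.smul_apply, smul_eq_mul] at h
  have h' : ((n.factorial : ℝ → ℝ) 0) = (n.factorial : ℝ) := rfl
  rw [h'] at h
  rw [← h, Finset.sum_mul]
  refine Finset.sum_congr rfl fun k hk => ?_
  have hk' : k ≤ n := by simpa [Nat.lt_succ_iff] using hk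
  rw [← mul_assoc, lagA_mul_risB]
  simp only [zsmul_eq_mul, hP, Polynomial.eval_comp, Polynomial.eval_mul, Polynomial.eval_C, Polynomial.eval_X]
  rw [Nat.add_sub_cancel' hk']
  push_cast [Nat.cast_choose ℝ hk']
  have e1 : (k:ℝ) * (β - 1) = (β - 1) * (0 + k • 1) := by simp; ring
  rw [e1]
  ring

lemma lag_genfun (β : ℝ) (h0 : 0 < β) (h1 : β < 1) (v : ℝ) (hv0 : 0 < v) (hv : v ≤ 1 / 8) :
    HasSum (fun k => lagA β k * (v * (1 + v) ^ (-β)) ^ k) (1 / (1 + (1 - β) * v)) := by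
  set f : ℕ × ℕ → ℝ := fun p => lagA β p.1 * (risB (p.1 * β) p.2 * (-1) ^ p.2) * v ^ (p.1 + p.2) with hf
  have hnorm : ∀ k m, ‖f (k, m)‖ = |lagA β k| * v ^ k * (risB (k * β) m * v ^ m) := by
    intro k m
    simp only [hf, norm_mul, Real.norm_eq_abs, abs_pow, abs_neg, abs_one, one_pow, mul_one,
      abs_of_pos hv0, abs_of_nonneg (risB_nonneg (k * β) (by positivity) m), pow_add]
    ring
  have hinner : ∀ k : ℕ, HasSum (fun m => ‖f (k, m)‖) (|lagA β k| * v ^ k * (1 - v) ^ (-(k * β))) := by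
    intro k
    simp only [hnorm]
    exact (risB_hasSum (k * β) v (by rw [abs_of_pos hv0]; linarith)).mul_left _
  have hS : Summable f := by
    apply Summable.of_norm
    rw [summable_prod_of_nonneg (fun _ => norm_nonneg _)]
    refine ⟨fun k => (hinner k).summable, ?_⟩
    simp only [fun k => (hinner k).tsum_eq]
    have he : Real.exp 1 < 2.7182818286 := Real.exp_one_lt_d9
    refine Summable.of_nonneg_of_le (fun k => ?_) (fun k => ?_)
      (summable_geometric_of_lt_one (r := Real.exp 1 * v * 2) (by positivity) (by nlinarith))
    · have : 0 < 1 - v := by linarith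
      positivity
    · have hb : (1 - v) ^ (-(k * β)) ≤ 2 ^ k := by
        have h12 : (1:ℝ)/2 ≤ 1 - v := by linarith
        calc (1 - v) ^ (-(k * β)) ≤ (1/2 : ℝ) ^ (-(k * β)) :=
              Real.rpow_le_rpow_of_nonpos (by norm_num) h12 (by
                have : 0 ≤ (k:ℝ) * β := by positivity
                linarith)
          _ = 2 ^ ((k:ℝ) * β) := by
              rw [one_div, Real.inv_rpow (by norm_num), Real.rpow_neg (by norm_num), inv_inv]
          _ ≤ 2 ^ (k:ℝ) := Real.rpow_le_rpow_of_exponent_le (by norm_num) (by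
                have : (0:ℝ) ≤ k := by positivity
                nlinarith)
          _ = _ := Real.rpow_natCast _ _
      have := abs_lagA_le β h0.le h1.le k
      rw [mul_pow, mul_pow]
      have hv1 : 0 < 1 - v := by linarith
      gcongr
  have hdiag : ∑' p, f p = 1 / (1 + (1 - β) * v) := by
    rw [← Finset.HasAntidiagonal.sigmaAntidiagonalEquivProd.tsum_eq f]
    refine (((Finset.HasAntidiagonal.sigmaAntidiagonalEquivProd.summable_iff (f := f)).mpr hS).tsum_sigma).trans ?_
    simp only [Function.comp_apply]
    have : ∀ n : ℕ, ∑' (c : Finset.HasAntidiagonal.antidiagonal n), f (Finset.HasAntidiagonal.sigmaAntidiagonalEquivProd ⟨n, c⟩) = ((β - 1) * v) ^ n := by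
      intro n
      rw [tsum_fintype]
      simp only [Finset.HasAntidiagonal.sigmaAntidiagonalEquivProd_apply]
      rw [Finset.sum_coe_sort (Finset.HasAntidiagonal.antidiagonal n) f, mul_pow, ← sum_lag β h1.ne n, Finset.sum_mul]
      refine Finset.sum_congr rfl fun p hp => ?_
      rw [← Finset.HasAntidiagonal.mem_antidiagonal.mp hp]
    simp only [this]
    rw [tsum_geometric_of_abs_lt_one]
    · rw [one_div]; congr 1; ring
    · rw [abs_lt]; constructor <;> nlinarith
  have hk : ∀ k : ℕ, HasSum (fun m => f (k, m)) (lagA β k * (v * (1 + v) ^ (-β)) ^ k) := by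
    intro k
    have := (risB_hasSum (k * β) (-v) (by rw [abs_neg, abs_of_pos hv0]; linarith)).mul_left (lagA β k * v ^ k)
    convert! this using 1
    · ext m
      simp only [hf, pow_add, neg_pow v m]; ring
    · rw [mul_pow, ← Real.rpow_natCast ((1+v)^(-β)), ← Real.rpow_mul (by linarith), sub_neg_eq_add]
      rw [show -β * (k:ℝ) = -(k * β) by ring]
      ring
  have := hS.hasSum.prod_fiberwise hk
  rwa [hdiag] at this

lemma Gamma_inv_step (z : ℝ) : (Real.Gamma z)⁻¹ = z * (Real.Gamma (z + 1))⁻¹ := by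
  rcases eq_or_ne z 0 with rfl | hz
  · simp [Real.Gamma_zero]
  · rw [Real.Gamma_add_one hz, mul_inv]
    field_simp

lemma Gamma_inv_asc (z : ℝ) (n : ℕ) :
    (Real.Gamma z)⁻¹ = (ascPochhammer ℝ n).eval z * (Real.Gamma (z + n))⁻¹ := by
  induction n with
  | zero => simp
  | succ n ih =>
    rw [ih, Gamma_inv_step (z + n), ascPochhammer_succ_eval]
    push_cast
    rw [add_assoc]; ring

/-- coefficients of the series -/
def cdfC (β : ℝ) (k : ℕ) : ℝ :=
  (-1 : ℝ) ^ k / (Nat.factorial (k + 1)) *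
      Real.Gamma (1 + ((k : ℝ) + 1) - ((k : ℝ) + 1) * β) *
      (Real.sin (Real.pi * ((k : ℝ) + 1) * β) /
        (Real.pi * ((k : ℝ) + 1) * β))

lemma cdf_eq (ρ x : ℝ) : multSelfSimilarCDF ρ x =
    ∑' k : ℕ, cdfC (ρ / (1 + ρ)) k * x ^ (((k : ℝ) + 1) * (ρ / (1 + ρ))) := by
  unfold multSelfSimilarCDF cdfC
  congr 1; ext k; ring

lemma cdfC_gamma (β : ℝ) (h0 : 0 < β) (h1 : β < 1) (k : ℕ) :
    cdfC β k * Real.Gamma (1 + ((k:ℝ) + 1) * β) = - lagA β (k + 1) := by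
  set a : ℝ := ((k:ℝ) + 1) * β with ha
  have ha0 : 0 < a := by positivity
  have han : a < k + 1 := by rw [ha]; nlinarith [(Nat.cast_nonneg k : (0:ℝ) ≤ k)]
  have hG : 0 < Real.Gamma a := Real.Gamma_pos_of_pos ha0
  have hG2 : 0 < Real.Gamma (1 - a + ((k + 1 : ℕ) : ℝ)) := Real.Gamma_pos_of_pos (by push_cast; linarith)
  have hrefl : (Real.Gamma (1 - a))⁻¹ = Real.Gamma a * Real.sin (Real.pi * a) / Real.pi := by
    have := congrArg Inv.inv (Real.Gamma_mul_Gamma_one_sub a)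
    rw [mul_inv, inv_div] at this
    rw [mul_div_assoc, ← this]
    field_simp
  have hasc : (ascPochhammer ℝ (k+1)).eval (1 - a) =
      Real.Gamma a * Real.sin (Real.pi * a) / Real.pi * Real.Gamma (1 - a + ((k + 1 : ℕ) : ℝ)) := by
    have := Gamma_inv_asc (1 - a) (k + 1)
    rw [hrefl] at this
    rw [this]; field_simp
  have hneg : (ascPochhammer ℝ (k+1)).eval (((k + 1 : ℕ) : ℝ) * β - ((k+1 : ℕ):ℝ)) =
      (-1) ^ (k + 1) * (ascPochhammer ℝ (k+1)).eval (1 - a) := by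
    have h3 := ascPochhammer_eval_neg_eq_descPochhammer ℝ (((k+1 : ℕ):ℝ) - a) (k+1)
    rw [descPochhammer_eval_eq_ascPochhammer] at h3
    rw [show ((k + 1 : ℕ) : ℝ) * β - ((k+1 : ℕ):ℝ) = -(((k+1 : ℕ):ℝ) - a) by rw [ha]; push_cast; ring, h3]
    congr 2; ring
  unfold cdfC lagA
  rw [hneg, hasc, show 1 + a = a + 1 by ring, Real.Gamma_add_one ha0.ne']
  rw [show Real.pi * ((k:ℝ) + 1) * β = Real.pi * a by rw [ha]; ring, ← ha]
  rw [show 1 + ((k:ℝ) + 1) - a = 1 - a + ((k + 1 : ℕ) : ℝ) by push_cast; ring]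
  have := Real.pi_pos
  field_simp
  ring

lemma cdf_term_integral (β q : ℝ) (h0 : 0 < β) (h1 : β < 1) (hq : 0 < q) (k : ℕ) :
    ∫ x in Ioi (0:ℝ), Real.exp (-(q * x)) * x ^ (((k:ℝ) + 1) * β) =
      q⁻¹ * (q ^ (-β)) ^ (k + 1) * Real.Gamma (1 + ((k:ℝ) + 1) * β) := by
  have := Real.integral_rpow_mul_exp_neg_mul_Ioi (a := 1 + ((k:ℝ) + 1) * β) (r := q) (by positivity) hq
  rw [add_sub_cancel_left] at this
  simp_rw [mul_comm (Real.exp _)]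
  rw [this, one_div, Real.inv_rpow hq.le, Real.rpow_add hq, Real.rpow_one, mul_inv, ← Real.rpow_natCast,
    ← Real.rpow_mul hq.le, ← Real.rpow_neg hq.le]
  congr 3; push_cast; ring

lemma cdf_term_integrable (β q : ℝ) (h0 : 0 < β) (h1 : β < 1) (hq : 0 < q) (k : ℕ) :
    IntegrableOn (fun x => Real.exp (-(q * x)) * x ^ (((k:ℝ) + 1) * β)) (Ioi (0:ℝ)) := by
  apply Integrable.of_integral_ne_zero
  rw [cdf_term_integral β q h0 h1 hq k]
  have := Real.Gamma_pos_of_pos (s := 1 + ((k:ℝ) + 1) * β) (by positivity)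
  positivity

lemma cdf_norm_summable (β q : ℝ) (h0 : 0 < β) (h1 : β < 1) (hq : 0 < q) (hw : q ^ (-β) ≤ 1 / 8) :
    Summable (fun k : ℕ => ∫ x in Ioi (0:ℝ), ‖Real.exp (-(q * x)) * (cdfC β k * x ^ (((k:ℝ) + 1) * β))‖) := by
  have he : Real.exp 1 < 2.7182818286 := Real.exp_one_lt_d9
  have hw0 : 0 < q ^ (-β) := by positivity
  have key : ∀ k : ℕ, ∫ x in Ioi (0:ℝ), ‖Real.exp (-(q * x)) * (cdfC β k * x ^ (((k:ℝ) + 1) * β))‖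
      = q⁻¹ * (|lagA β (k+1)| * (q ^ (-β)) ^ (k + 1)) := by
    intro k
    have : ∫ x in Ioi (0:ℝ), ‖Real.exp (-(q * x)) * (cdfC β k * x ^ (((k:ℝ) + 1) * β))‖
        = ∫ x in Ioi (0:ℝ), |cdfC β k| * (Real.exp (-(q * x)) * x ^ (((k:ℝ) + 1) * β)) := by
      refine setIntegral_congr_fun measurableSet_Ioi fun x hx => ?_
      have hx' : (0:ℝ) < x := hx
      simp only [norm_mul, Real.norm_eq_abs, Real.abs_exp, abs_of_pos (Real.rpow_pos_of_pos hx' _)]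
      ring
    rw [this, integral_const_mul, cdf_term_integral β q h0 h1 hq k]
    have hG := Real.Gamma_pos_of_pos (s := 1 + ((k:ℝ) + 1) * β) (by positivity)
    have := congrArg abs (cdfC_gamma β h0 h1 k)
    rw [abs_mul, abs_of_pos hG, abs_neg] at this
    rw [← this]; ring
  simp only [key]
  apply Summable.mul_left
  have : Summable (fun k : ℕ => |lagA β k| * (q ^ (-β)) ^ k) := by
    refine Summable.of_nonneg_of_le (fun k => by positivity) (fun k => ?_)
      (summable_geometric_of_lt_one (r := Real.exp 1 * q ^ (-β)) (by positivity) (by nlinarith))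
    rw [mul_pow]
    gcongr
    exact abs_lagA_le β h0.le h1.le k
  exact (summable_nat_add_iff 1).mpr this

lemma cdf_abs_summable (β : ℝ) (h0 : 0 < β) (h1 : β < 1) (X : ℝ) (hX : 0 < X) :
    Summable (fun k : ℕ => |cdfC β k| * X ^ (((k:ℝ) + 1) * β)) := by
  obtain ⟨q, hq, hw⟩ : ∃ q : ℝ, 0 < q ∧ q ^ (-β) ≤ 1 / 8 := by
    refine ⟨8 ^ (1/β), by positivity, ?_⟩
    rw [← Real.rpow_mul (by norm_num)]
    rw [show 1 / β * -β = -1 by field_simp, Real.rpow_neg_one]; norm_num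
  have hs := cdf_norm_summable β q h0 h1 hq hw
  refine Summable.of_nonneg_of_le (fun k => by positivity) (fun k => ?_) (hs.mul_left (Real.exp (q * (X + 1))))
  have hint : IntegrableOn (fun x => ‖Real.exp (-(q * x)) * (cdfC β k * x ^ (((k:ℝ) + 1) * β))‖) (Ioi (0:ℝ)) := by
    apply Integrable.norm
    have := (cdf_term_integrable β q h0 h1 hq k).const_mul (cdfC β k)
    refine this.congr (ae_of_all _ fun x => ?_)
    simp only; ring
  have h2 : Real.exp (-(q * (X + 1))) * (|cdfC β k| * X ^ (((k:ℝ) + 1) * β)) ≤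
      ∫ x in Ioi (0:ℝ), ‖Real.exp (-(q * x)) * (cdfC β k * x ^ (((k:ℝ) + 1) * β))‖ := by
    calc _ = ∫ x in Ioc X (X+1), Real.exp (-(q * (X + 1))) * (|cdfC β k| * X ^ (((k:ℝ) + 1) * β)) := by
          simp
      _ ≤ ∫ x in Ioc X (X+1), ‖Real.exp (-(q * x)) * (cdfC β k * x ^ (((k:ℝ) + 1) * β))‖ := by
          refine setIntegral_mono_on (integrableOn_const (by simp)) (hint.mono_set fun y hy => ?_) measurableSet_Ioc fun x hx => ?_
          · exact lt_trans hX hy.1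
          · have hx0 : 0 < x := lt_trans hX hx.1
            rw [norm_mul, norm_mul, Real.norm_eq_abs, Real.norm_eq_abs, Real.norm_eq_abs, Real.abs_exp, abs_of_pos (Real.rpow_pos_of_pos hx0 _)]
            have := hx.1.le
            have := hx.2
            gcongr
      _ ≤ _ := setIntegral_mono_set hint (ae_of_all _ fun x => norm_nonneg _)
          (Filter.Eventually.of_forall fun y (hy : y ∈ Ioc X (X+1)) => lt_trans hX hy.1)
  calc _ = Real.exp (q * (X + 1)) * (Real.exp (-(q * (X + 1))) * (|cdfC β k| * X ^ (((k:ℝ) + 1) * β))) := by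
        rw [← mul_assoc, ← Real.exp_add]; simp
    _ ≤ _ := by gcongr

lemma cdf_continuousOn (ρ : ℝ) (hρ : 0 < ρ) : ContinuousOn (multSelfSimilarCDF ρ) (Ici 0) := by
  have h0 : 0 < ρ / (1 + ρ) := by positivity
  have h1 : ρ / (1 + ρ) < 1 := by rw [div_lt_one (by positivity)]; linarith
  set β := ρ / (1 + ρ) with hβ
  intro x hx
  have hx' : (0:ℝ) ≤ x := hx
  have hc : ContinuousOn (multSelfSimilarCDF ρ) (Icc 0 (x + 1)) := by
    have : multSelfSimilarCDF ρ = fun x => ∑' k : ℕ, cdfC β k * x ^ (((k : ℝ) + 1) * β) := by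
      ext x; exact cdf_eq ρ x
    rw [this]
    refine continuousOn_tsum (fun k => ?_) (cdf_abs_summable β h0 h1 (x+1) (by linarith)) ?_
    · apply ContinuousOn.mul continuousOn_const
      exact (Real.continuous_rpow_const (by positivity)).continuousOn
    · intro k y hy
      rw [norm_mul, Real.norm_eq_abs, Real.norm_eq_abs, abs_of_nonneg (Real.rpow_nonneg hy.1 _)]
      have := hy.1
      have := hy.2
      gcongr
  have := hc x ⟨hx', by linarith⟩
  refine this.mono_of_mem_nhdsWithin ?_
  rw [mem_nhdsWithin]
  exact ⟨Iio (x+1), isOpen_Iio, by simp, fun y hy => ⟨hy.2, le_of_lt hy.1⟩⟩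

lemma cdf_laplace (ρ : ℝ) (hρ : 0 < ρ) (θ : ℝ) (hθ : 0 < θ) (hv : θ ^ (-ρ) ≤ 1 / 8) :
    ∫ x in Ioi (0:ℝ), Real.exp (-((θ + θ ^ (1 + ρ)) * x)) * multSelfSimilarCDF ρ x =
      (θ + θ ^ (1 + ρ))⁻¹ * (1 / (1 + (1 + ρ) * θ ^ ρ)) := by
  have h0 : 0 < ρ / (1 + ρ) := by positivity
  have h1 : ρ / (1 + ρ) < 1 := by rw [div_lt_one (by positivity)]; linarith
  set β := ρ / (1 + ρ) with hβ
  set q := θ + θ ^ (1 + ρ) with hq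
  have hq0 : 0 < q := by positivity
  set v := θ ^ (-ρ) with hvdef
  have hv0 : 0 < v := by positivity
  have hw : q ^ (-β) = v * (1 + v) ^ (-β) := by
    have : q = θ ^ (1 + ρ) * (1 + v) := by
      rw [mul_add, hvdef, ← Real.rpow_add hθ, hq]; simp [add_comm]
    rw [this, Real.mul_rpow (by positivity) (by positivity), ← Real.rpow_mul hθ.le]
    congr 2
    rw [hβ]; field_simp
  have hw8 : q ^ (-β) ≤ 1 / 8 := by
    rw [hw]
    calc v * (1 + v) ^ (-β) ≤ v * 1 := by
          gcongr
          exact Real.rpow_le_one_of_one_le_of_nonpos (by linarith) (by linarith)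
      _ ≤ _ := by linarith
  have hsum := hasSum_integral_of_summable_integral_norm (μ := volume.restrict (Ioi (0:ℝ)))
    (F := fun (k:ℕ) x => Real.exp (-(q * x)) * (cdfC β k * x ^ (((k:ℝ) + 1) * β))) (fun k => by
      have := (cdf_term_integrable β q h0 h1 hq0 k).const_mul (cdfC β k)
      refine this.congr (ae_of_all _ fun x => ?_)
      simp only; ring) (cdf_norm_summable β q h0 h1 hq0 hw8)
  have e1 : ∀ x, Real.exp (-(q * x)) * multSelfSimilarCDF ρ x =
      ∑' k : ℕ, Real.exp (-(q * x)) * (cdfC β k * x ^ (((k:ℝ) + 1) * β)) := by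
    intro x; rw [cdf_eq, tsum_mul_left]
  simp_rw [e1]
  refine hsum.unique ?_
  have e2 : ∀ k : ℕ, ∫ x in Ioi (0:ℝ), Real.exp (-(q * x)) * (cdfC β k * x ^ (((k:ℝ) + 1) * β)) =
      q⁻¹ * -(lagA β (k + 1) * (v * (1 + v) ^ (-β)) ^ (k + 1)) := by
    intro k
    have : ∫ x in Ioi (0:ℝ), Real.exp (-(q * x)) * (cdfC β k * x ^ (((k:ℝ) + 1) * β))
        = ∫ x in Ioi (0:ℝ), cdfC β k * (Real.exp (-(q * x)) * x ^ (((k:ℝ) + 1) * β)) := by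
      congr 1; ext x; ring
    rw [this, integral_const_mul, cdf_term_integral β q h0 h1 hq0 k, ← hw]
    linear_combination q⁻¹ * (q ^ (-β)) ^ (k+1) * cdfC_gamma β h0 h1 k
  simp_rw [e2]
  apply HasSum.mul_left
  have hg := lag_genfun β h0 h1 v hv0 hv
  have hg1 := ((hasSum_nat_add_iff' 1).mpr hg).neg
  convert! hg1 using 1
  simp only [Finset.range_one, Finset.sum_singleton, pow_zero, mul_one]
  have hl0 : lagA β 0 = 1 := by simp [lagA]
  rw [hl0]
  have hb : 1 - β = 1 / (1 + ρ) := by rw [hβ]; field_simp; ring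
  have hvi : θ ^ ρ = 1 / v := by rw [hvdef, Real.rpow_neg hθ.le]; simp
  rw [hb, hvi]
  field_simp
  ring

lemma poly_integral (N : ℕ) (f : ℝ → ℝ)
    (hf : ∀ n : ℕ, N ≤ n → IntegrableOn (fun x => Real.exp (-(n * x)) * f x) (Ioi (0:ℝ))) (p : Polynomial ℝ) :
    IntegrableOn (fun x => Real.exp (-(N * x)) * p.eval (Real.exp (-x)) * f x) (Ioi (0:ℝ)) ∧
    ∫ x in Ioi (0:ℝ), Real.exp (-(N * x)) * p.eval (Real.exp (-x)) * f x =
      ∑ j ∈ Finset.range (p.natDegree + 1), p.coeff j * ∫ x in Ioi (0:ℝ), Real.exp (-((N + j : ℕ) * x)) * f x := by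
  have e : (fun x => Real.exp (-(N * x)) * p.eval (Real.exp (-x)) * f x) =
      fun x => ∑ j ∈ Finset.range (p.natDegree + 1), p.coeff j * (Real.exp (-((N + j : ℕ) * x)) * f x) := by
    ext x
    rw [Polynomial.eval_eq_sum_range, Finset.mul_sum, Finset.sum_mul]
    refine Finset.sum_congr rfl fun j _ => ?_
    rw [← Real.exp_nat_mul]
    have : Real.exp (-((N + j : ℕ) * x)) = Real.exp (-(N * x)) * Real.exp (j * -x) := by
      rw [← Real.exp_add]; congr 1; push_cast; ring
    rw [this]; ring
  have hI : ∀ j ∈ Finset.range (p.natDegree + 1), Integrable (fun x => p.coeff j * (Real.exp (-((N + j : ℕ) * x)) * f x))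
      (volume.restrict (Ioi (0:ℝ))) := fun j _ => (hf (N + j) (by omega)).const_mul _
  rw [e]
  refine ⟨integrable_finsetSum _ hI, ?_⟩
  rw [integral_finsetSum _ hI]
  simp_rw [integral_const_mul]

lemma test_integrable (N : ℕ) (f : ℝ → ℝ)
    (hf : IntegrableOn (fun x => Real.exp (-(N * x)) * f x) (Ioi (0:ℝ))) (h : ℝ → ℝ) (hh : Continuous h) :
    IntegrableOn (fun x => Real.exp (-(N * x)) * h (Real.exp (-x)) * f x) (Ioi (0:ℝ)) := by
  obtain ⟨C, hC⟩ := isCompact_Icc.exists_bound_of_continuousOn (s := Icc (0:ℝ) 1) hh.continuousOn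
  have := hf.bdd_mul (c := C) (f := fun x => h (Real.exp (-x)))
    (by exact (hh.comp (by fun_prop)).aestronglyMeasurable) (by
      rw [ae_restrict_iff' measurableSet_Ioi]
      refine ae_of_all _ fun x hx => hC _ ⟨(Real.exp_pos _).le, ?_⟩
      have : (0:ℝ) < x := hx
      simp [this.le])
  refine this.congr (ae_of_all _ fun x => ?_)
  simp only; ring

lemma test_diff (N : ℕ) (f : ℝ → ℝ)
    (hf : IntegrableOn (fun x => Real.exp (-(N * x)) * f x) (Ioi (0:ℝ))) (h g : ℝ → ℝ) (hh : Continuous h)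
    (hg : Continuous g) (ε : ℝ) (hε : ∀ y ∈ Icc (0:ℝ) 1, |g y - h y| < ε) :
    |(∫ x in Ioi (0:ℝ), Real.exp (-(N * x)) * g (Real.exp (-x)) * f x) -
      ∫ x in Ioi (0:ℝ), Real.exp (-(N * x)) * h (Real.exp (-x)) * f x| ≤
      ε * ∫ x in Ioi (0:ℝ), |Real.exp (-(N * x)) * f x| := by
  rw [← integral_sub (test_integrable N f hf g hg) (test_integrable N f hf h hh), ← integral_const_mul,
    ← Real.norm_eq_abs]
  refine norm_integral_le_of_norm_le (hf.abs.const_mul _) ?_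
  rw [ae_restrict_iff' measurableSet_Ioi]
  refine ae_of_all _ fun x hx => ?_
  have hx : (0:ℝ) < x := hx
  have := hε (Real.exp (-x)) ⟨(Real.exp_pos _).le, by simp [hx.le]⟩
  rw [show Real.exp (-(N * x)) * g (Real.exp (-x)) * f x - Real.exp (-(N * x)) * h (Real.exp (-x)) * f x =
    (g (Real.exp (-x)) - h (Real.exp (-x))) * (Real.exp (-(N * x)) * f x) by ring, norm_mul, Real.norm_eq_abs, Real.norm_eq_abs]
  gcongr

lemma exp_bdd_integrable (n : ℕ) (hn : 1 ≤ n) (G : ℝ → ℝ) (hG : Monotone G) (h01 : ∀ x, 0 ≤ G x ∧ G x ≤ 1) :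
    IntegrableOn (fun x => Real.exp (-(n * x)) * G x) (Ioi (0:ℝ)) ∧
    ∫ x in Ioi (0:ℝ), |Real.exp (-(n * x)) * G x| ≤ 1 := by
  have hn' : (1:ℝ) ≤ n := by exact_mod_cast hn
  have he : IntegrableOn (fun x => Real.exp (-((n:ℝ) * x))) (Ioi (0:ℝ)) := by
    simpa [neg_mul] using exp_neg_integrableOn_Ioi 0 (b := (n:ℝ)) (by linarith)
  have hI : IntegrableOn (fun x => Real.exp (-(n * x)) * G x) (Ioi (0:ℝ)) := by
    refine Integrable.mono' he ?_ (ae_of_all _ fun x => ?_)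
    · exact ((by fun_prop : Measurable fun x : ℝ => Real.exp (-((n:ℝ) * x))).mul hG.measurable).aestronglyMeasurable
    · rw [Real.norm_eq_abs, abs_mul, Real.abs_exp, abs_of_nonneg (h01 x).1]
      exact mul_le_of_le_one_right (Real.exp_pos _).le (h01 x).2
  refine ⟨hI, ?_⟩
  calc _ ≤ ∫ x in Ioi (0:ℝ), Real.exp (-((n:ℝ) * x)) := by
        refine integral_mono hI.abs he fun x => ?_
        simp only
        rw [abs_mul, Real.abs_exp, abs_of_nonneg (h01 x).1]
        exact mul_le_of_le_one_right (Real.exp_pos _).le (h01 x).2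
    _ = 1 / n := by
        have := integral_exp_neg_mul_rpow (p := 1) (b := (n:ℝ)) one_pos (by linarith)
        rw [one_div_one, Real.Gamma_add_one one_ne_zero] at this; simp [Real.rpow_neg_one] at this
        simpa [IntegrableOn] using this
    _ ≤ 1 := by rw [div_le_one (by linarith)]; exact hn'

lemma test_tendsto {ι : Type*} {l : Filter ι} (G : ι → ℝ → ℝ) (M : ℝ → ℝ) (N : ℕ) (hN : 1 ≤ N)
    (hG : ∀ᶠ i in l, Monotone (G i) ∧ ∀ x, 0 ≤ G i x ∧ G i x ≤ 1)
    (hM : ∀ n : ℕ, N ≤ n → IntegrableOn (fun x => Real.exp (-(n * x)) * M x) (Ioi (0:ℝ)))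
    (hconv : ∀ n : ℕ, N ≤ n → Tendsto (fun i => ∫ x in Ioi (0:ℝ), Real.exp (-(n * x)) * G i x) l
      (𝓝 (∫ x in Ioi (0:ℝ), Real.exp (-(n * x)) * M x)))
    (h : ℝ → ℝ) (hh : Continuous h) :
    Tendsto (fun i => ∫ x in Ioi (0:ℝ), Real.exp (-(N * x)) * h (Real.exp (-x)) * G i x) l
      (𝓝 (∫ x in Ioi (0:ℝ), Real.exp (-(N * x)) * h (Real.exp (-x)) * M x)) := by
  rw [Metric.tendsto_nhds]
  intro ε hε
  set C := ∫ x in Ioi (0:ℝ), |Real.exp (-(N * x)) * M x| with hC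
  have hC0 : 0 ≤ C := integral_nonneg fun x => abs_nonneg _
  set δ := ε / (4 * (1 + C)) with hδ
  have hδ0 : 0 < δ := by positivity
  obtain ⟨p, hp⟩ := exists_polynomial_near_of_continuousOn 0 1 h hh.continuousOn δ hδ0
  have hpM := poly_integral N M hM p
  have hpc : Tendsto (fun i => ∫ x in Ioi (0:ℝ), Real.exp (-(N * x)) * p.eval (Real.exp (-x)) * G i x) l
      (𝓝 (∫ x in Ioi (0:ℝ), Real.exp (-(N * x)) * p.eval (Real.exp (-x)) * M x)) := by
    rw [hpM.2]
    have : Tendsto (fun i => ∑ j ∈ Finset.range (p.natDegree + 1), p.coeff j * ∫ x in Ioi (0:ℝ), Real.exp (-((N + j : ℕ) * x)) * G i x) l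
        (𝓝 (∑ j ∈ Finset.range (p.natDegree + 1), p.coeff j * ∫ x in Ioi (0:ℝ), Real.exp (-((N + j : ℕ) * x)) * M x)) :=
      tendsto_finsetSum _ fun j _ => (hconv (N + j) (by omega)).const_mul _
    refine this.congr' ?_
    filter_upwards [hG] with i hi
    exact (poly_integral N (G i) (fun n hn => (exp_bdd_integrable n (hN.trans hn) (G i) hi.1 hi.2).1) p).2.symm
  rw [Metric.tendsto_nhds] at hpc
  filter_upwards [hG, hpc (ε/2) (by positivity)] with i hi hi2
  have hGi := exp_bdd_integrable N hN (G i) hi.1 hi.2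
  have d1 := test_diff N (G i) hGi.1 h (fun y => p.eval y) hh p.continuous δ hp
  have d2 := test_diff N M (hM N le_rfl) h (fun y => p.eval y) hh p.continuous δ hp
  rw [← hC] at d2
  have d1' := d1.trans (mul_le_of_le_one_right hδ0.le hGi.2)
  have hsum : δ + δ * C = ε / 4 := by rw [hδ]; field_simp
  rw [Real.dist_eq] at hi2 ⊢
  rw [abs_lt] at hi2 ⊢
  rw [abs_le] at d1' d2
  constructor <;> linarith [hi2.1, hi2.2, d1'.1, d1'.2, d2.1, d2.2]

/-- bump test function -/
def bump (a b : ℝ) (y : ℝ) : ℝ := max 0 ((y - Real.exp (-b)) * (Real.exp (-a) - y))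

lemma bump_cont (a b : ℝ) : Continuous (bump a b) := by unfold bump; fun_prop

lemma bump_nonneg (a b y : ℝ) : 0 ≤ bump a b y := le_max_left _ _

lemma bump_zero (a b x : ℝ) (hab : a < b) (hx : x ∉ Ioo a b) : bump a b (Real.exp (-x)) = 0 := by
  unfold bump
  apply max_eq_left
  have hba : Real.exp (-b) < Real.exp (-a) := by simpa
  by_cases h : x ≤ a
  · have h1 : Real.exp (-a) ≤ Real.exp (-x) := by simpa
    exact mul_nonpos_of_nonneg_of_nonpos (by linarith) (by linarith)
  · have h2 : b ≤ x := by
      by_contra h3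
      exact hx ⟨by linarith, by linarith⟩
    have h1 : Real.exp (-x) ≤ Real.exp (-b) := by simpa
    exact mul_nonpos_of_nonpos_of_nonneg (by linarith) (by linarith)

lemma bump_pos (a b x : ℝ) (hx : x ∈ Ioo a b) : 0 < bump a b (Real.exp (-x)) := by
  unfold bump
  refine lt_max_of_lt_right (mul_pos ?_ ?_)
  · simpa using hx.2
  · simpa using hx.1

lemma bump_int_pos (N : ℕ) (hN : 1 ≤ N) (a b : ℝ) (ha : 0 ≤ a) (hab : a < b) :
    0 < ∫ x in Ioi (0:ℝ), Real.exp (-(N * x)) * bump a b (Real.exp (-x)) := by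
  have h1 := (exp_bdd_integrable N hN (fun _ => 1) (fun _ _ _ => le_rfl) (fun x => ⟨zero_le_one, le_rfl⟩)).1
  have h2 := test_integrable N _ h1 _ (bump_cont a b)
  simp only [mul_one] at h2
  rw [setIntegral_pos_iff_support_of_nonneg_ae (ae_of_all _ fun x => mul_nonneg (Real.exp_pos _).le (bump_nonneg _ _ _)) h2]
  refine lt_of_lt_of_le ?_ (measure_mono (s := Ioo a b) fun x hx => ⟨?_, lt_of_le_of_lt ha hx.1⟩)
  · simp [hab]
  · exact (mul_pos (Real.exp_pos _) (bump_pos a b x hx)).ne'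

lemma laplace_cont {ι : Type*} {l : Filter ι} (G : ι → ℝ → ℝ) (M : ℝ → ℝ) (N : ℕ) (hN : 1 ≤ N)
    (hG : ∀ᶠ i in l, Monotone (G i) ∧ ∀ x, 0 ≤ G i x ∧ G i x ≤ 1)
    (hMc : ContinuousOn M (Ici 0))
    (hM : ∀ n : ℕ, N ≤ n → IntegrableOn (fun x => Real.exp (-(n * x)) * M x) (Ioi (0:ℝ)))
    (hconv : ∀ n : ℕ, N ≤ n → Tendsto (fun i => ∫ x in Ioi (0:ℝ), Real.exp (-(n * x)) * G i x) l
      (𝓝 (∫ x in Ioi (0:ℝ), Real.exp (-(n * x)) * M x)))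
    (x : ℝ) (hx : 0 < x) : Tendsto (fun i => G i x) l (𝓝 (M x)) := by
  rw [Metric.tendsto_nhds]
  intro ε hε
  have hcx : ContinuousAt M x := hMc.continuousAt (Ici_mem_nhds hx)
  obtain ⟨δ', hδ', hcδ⟩ := Metric.continuousAt_iff.mp hcx (ε/2) (by positivity)
  set δ := min (δ'/2) (x/2) with hδ
  have hδ0 : 0 < δ := by positivity
  have hδ1 : δ < δ' := lt_of_le_of_lt (min_le_left _ _) (by linarith)
  have hδ2 : δ < x := lt_of_le_of_lt (min_le_right _ _) (by linarith)
  have hone := (exp_bdd_integrable N hN (fun _ => 1) (fun _ _ _ => le_rfl) (fun x => ⟨zero_le_one, le_rfl⟩)).1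
  have hclose : ∀ y, |y - x| ≤ δ → M y < M x + ε/2 ∧ M x - ε/2 < M y := by
    intro y hy
    have := hcδ (x := y) (by rw [Real.dist_eq]; linarith)
    rw [Real.dist_eq, abs_lt] at this
    constructor <;> linarith [this.1, this.2]
  -- general comparison: f ≤ g on (a,b)
  have hcomp : ∀ (a b : ℝ) (_ : a < b) (f g : ℝ → ℝ)
      (_ : IntegrableOn (fun x => Real.exp (-(N * x)) * f x) (Ioi (0:ℝ)))
      (_ : IntegrableOn (fun x => Real.exp (-(N * x)) * g x) (Ioi (0:ℝ)))
      (_ : ∀ y ∈ Ioo a b, f y ≤ g y),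
      ∫ x in Ioi (0:ℝ), Real.exp (-(N * x)) * bump a b (Real.exp (-x)) * f x ≤
      ∫ x in Ioi (0:ℝ), Real.exp (-(N * x)) * bump a b (Real.exp (-x)) * g x := by
    intro a b hab f g hf hg hfg
    refine integral_mono (test_integrable N f hf _ (bump_cont a b)) (test_integrable N g hg _ (bump_cont a b)) fun y => ?_
    by_cases hy : y ∈ Ioo a b
    · exact mul_le_mul_of_nonneg_left (hfg y hy) (mul_nonneg (Real.exp_pos _).le (bump_nonneg _ _ _))
    · simp [bump_zero a b y hab hy]
  have hconst : ∀ (a b c : ℝ), ∫ x in Ioi (0:ℝ), Real.exp (-(N * x)) * bump a b (Real.exp (-x)) * c =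
      (∫ x in Ioi (0:ℝ), Real.exp (-(N * x)) * bump a b (Real.exp (-x))) * c := by
    intro a b c; rw [integral_mul_const]
  have hcI : ∀ c : ℝ, IntegrableOn (fun x => Real.exp (-(N * x)) * c) (Ioi (0:ℝ)) := by
    intro c
    have := hone.mul_const c
    simpa [IntegrableOn] using this
  -- upper
  set J1 := ∫ y in Ioi (0:ℝ), Real.exp (-(N * y)) * bump x (x + δ) (Real.exp (-y)) with hJ1
  have hJ1p : 0 < J1 := bump_int_pos N hN _ _ hx.le (by linarith)
  have t1 := test_tendsto G M N hN hG hM hconv _ (bump_cont x (x+δ))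
  have u1 := hcomp x (x + δ) (by linarith) M (fun _ => M x + ε/2) (hM N le_rfl) (hcI _) (fun y hy =>
    (hclose y (by rw [abs_le]; constructor <;> linarith [hy.1, hy.2])).1.le)
  rw [hconst] at u1
  -- lower
  set J2 := ∫ y in Ioi (0:ℝ), Real.exp (-(N * y)) * bump (x - δ) x (Real.exp (-y)) with hJ2
  have hJ2p : 0 < J2 := bump_int_pos N hN _ _ (by linarith) (by linarith)
  have t2 := test_tendsto G M N hN hG hM hconv _ (bump_cont (x-δ) x)
  have u2 := hcomp (x - δ) x (by linarith) (fun _ => M x - ε/2) M (hcI _) (hM N le_rfl) (fun y hy =>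
    (hclose y (by rw [abs_le]; constructor <;> linarith [hy.1, hy.2])).2.le)
  rw [hconst] at u2
  have ev1 := t1.eventually_lt_const (u := J1 * (M x + ε)) (by nlinarith)
  have ev2 := t2.eventually_const_lt (u := J2 * (M x - ε)) (by nlinarith)
  filter_upwards [hG, ev1, ev2] with i hi h1 h2
  have hGi := (exp_bdd_integrable N hN (G i) hi.1 hi.2).1
  have c1 := hcomp x (x + δ) (by linarith) (fun _ => G i x) (G i) (hcI _) hGi (fun y hy => hi.1 hy.1.le)
  have c2 := hcomp (x - δ) x (by linarith) (G i) (fun _ => G i x) hGi (hcI _) (fun y hy => hi.1 hy.2.le)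
  rw [hconst] at c1 c2
  rw [Real.dist_eq, abs_lt]
  have a1 : G i x < M x + ε := lt_of_mul_lt_mul_left (c1.trans_lt h1) hJ1p.le
  have a2 : M x - ε < G i x := lt_of_mul_lt_mul_left (h2.trans_le c2) hJ2p.le
  constructor <;> linarith

lemma fubini_layer (m : Measure ℝ) [SFinite m] (hm : m (Iic 0) = 0) (k K : ℝ → ENNReal) (hk : Measurable k)
    (hK : ∀ x, 0 < x → K x = ∫⁻ y in Ici x, k y) :
    ∫⁻ x, K x ∂m = ∫⁻ y in Ioi (0:ℝ), m (Iic y) * k y := by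
  have hae : ∀ᵐ x ∂m, 0 < x := by
    rw [ae_iff]; simpa [Iic_def] using hm
  have e1 : ∫⁻ x, K x ∂m = ∫⁻ x, (∫⁻ y in Ioi (0:ℝ), ({p : ℝ × ℝ | p.1 ≤ p.2}.indicator (fun p => k p.2)) (x, y)) ∂m := by
    refine lintegral_congr_ae ?_
    filter_upwards [hae] with x hx
    rw [hK x hx]
    have : ∀ y, ({p : ℝ × ℝ | p.1 ≤ p.2}.indicator (fun p => k p.2)) (x, y) = (Ici x).indicator k y := by
      intro y; by_cases h : x ≤ y <;> simp [h, indicator]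
    simp_rw [this]
    rw [setLIntegral_indicator measurableSet_Ici]
    congr 2
    ext y; simp only [mem_inter_iff, mem_Ici, mem_Ioi]
    exact ⟨fun h => ⟨h, lt_of_lt_of_le hx h⟩, fun h => h.1⟩
  rw [e1, lintegral_lintegral_swap]
  · refine lintegral_congr fun y => ?_
    have : ∀ x, ({p : ℝ × ℝ | p.1 ≤ p.2}.indicator (fun p => k p.2)) (x, y) = (Iic y).indicator (fun _ => k y) x := by
      intro x; by_cases h : x ≤ y <;> simp [h, indicator]
    simp_rw [this]
    rw [lintegral_indicator measurableSet_Iic, setLIntegral_const, mul_comm]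
  · exact ((hk.comp measurable_snd).indicator (measurableSet_le measurable_fst measurable_snd)).aemeasurable

/-- kernel -/
def kk (u : ℝ) : ℝ := (1 - (1 + u) * Real.exp (-u)) / u ^ 2

lemma kk_meas : Measurable kk := by unfold kk; fun_prop

lemma kk_nonneg (u : ℝ) (hu : 0 < u) : 0 ≤ kk u := by
  unfold kk
  have : (1 + u) * Real.exp (-u) ≤ 1 := by
    calc (1 + u) * Real.exp (-u) ≤ Real.exp u * Real.exp (-u) := by
          gcongr; linarith [Real.add_one_le_exp u]
      _ = 1 := by rw [← Real.exp_add]; simp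
  apply div_nonneg <;> nlinarith

lemma kk_pos (u : ℝ) (hu : 0 < u) : 0 < kk u := by
  unfold kk
  have : (1 + u) * Real.exp (-u) < 1 := by
    calc (1 + u) * Real.exp (-u) < Real.exp u * Real.exp (-u) := by
          gcongr; linarith [Real.add_one_lt_exp hu.ne']
      _ = 1 := by rw [← Real.exp_add]; simp
  apply div_pos <;> nlinarith

lemma kk_le_one (u : ℝ) (hu : 0 < u) : kk u ≤ 1 := by
  unfold kk
  rw [div_le_one (by positivity)]
  nlinarith [Real.add_one_le_exp (-u)]

lemma kk_le (u : ℝ) (hu : 0 < u) : kk u ≤ u ^ (-2 : ℝ) := by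
  unfold kk
  rw [Real.rpow_neg hu.le, ← one_div, Real.rpow_two]
  gcongr
  have := Real.exp_pos (-u)
  nlinarith

lemma kk_tail (s x : ℝ) (hs : 0 < s) (hx : 0 < x) :
    ∫⁻ y in Ici x, ENNReal.ofReal (s ^ 2 * kk (s * y)) = ENNReal.ofReal ((1 - Real.exp (-(s * x))) / x) := by
  have hd : ∀ y ∈ Ici x, HasDerivAt (fun y => -((1 - Real.exp (-(s * y))) / y)) (s ^ 2 * kk (s * y)) y := by
    intro y hy
    have hy0 : 0 < y := lt_of_lt_of_le hx hy
    have h1 : HasDerivAt (fun y : ℝ => Real.exp (-(s * y))) (Real.exp (-(s * y)) * (-(s * 1))) y :=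
      (((hasDerivAt_id y).const_mul s).neg).exp
    have h2 := ((h1.const_sub 1).div (hasDerivAt_id y) hy0.ne').neg
    convert! h2 using 1
    unfold kk
    simp only [id]
    field_simp
    ring
  have hnn : ∀ y ∈ Ioi x, 0 ≤ s ^ 2 * kk (s * y) := by
    intro y hy
    have hy0 : 0 < y := lt_trans hx hy
    exact mul_nonneg (by positivity) (kk_nonneg _ (by positivity))
  have hlim : Tendsto (fun y => -((1 - Real.exp (-(s * y))) / y)) atTop (𝓝 0) := by
    have h3 : Tendsto (fun y : ℝ => Real.exp (-(s * y))) atTop (𝓝 0) :=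
      Real.tendsto_exp_neg_atTop_nhds_zero.comp (tendsto_id.const_mul_atTop hs)
    have h4 := ((h3.const_sub 1).div_atTop tendsto_id).neg
    simpa using h4
  have hI := integrableOn_Ioi_deriv_of_nonneg' hd hnn hlim
  have hV := integral_Ioi_of_hasDerivAt_of_nonneg' hd hnn hlim
  rw [setLIntegral_congr Ioi_ae_eq_Ici.symm, ← ofReal_integral_eq_lintegral_ofReal hI ((ae_restrict_iff' measurableSet_Ioi).mpr (ae_of_all _ hnn)), hV]
  congr 1; ring

lemma potter (U : ℝ → ℝ) (hmono : Monotone U) (α γ : ℝ) (hγ0 : 0 < γ) (hγ : α < γ)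
    (hpos : ∀ᶠ x in atTop, 0 < U x)
    (hrv : ∀ c : ℝ, 0 < c → Tendsto (fun x => U (c * x) / U x) atTop (𝓝 (c ^ α))) :
    ∀ᶠ x in atTop, 0 < U x ∧ ∀ u : ℝ, 1 ≤ u → U (u * x) ≤ (2 ^ γ * u ^ γ) * U x := by
  have h2 : (2:ℝ) ^ α < 2 ^ γ := Real.rpow_lt_rpow_of_exponent_lt (by norm_num) hγ
  have hev := (hrv 2 (by norm_num)).eventually_lt_const h2
  obtain ⟨x0, hx0⟩ := eventually_atTop.mp (hpos.and hev)
  filter_upwards [eventually_ge_atTop x0, eventually_ge_atTop 0] with x hx hx00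
  have hstep : ∀ y, x0 ≤ y → U (2 * y) ≤ 2 ^ γ * U y := by
    intro y hy
    have := hx0 y hy
    rw [div_lt_iff₀ this.1] at this
    exact this.2.le
  refine ⟨(hx0 x hx).1, fun u hu => ?_⟩
  have hiter : ∀ n : ℕ, U (2 ^ n * x) ≤ (2 ^ γ) ^ n * U x := by
    intro n
    induction n with
    | zero => simp
    | succ n ih =>
      have hle : x0 ≤ 2 ^ n * x := by
        have : (1:ℝ) ≤ 2 ^ n := one_le_pow₀ (by norm_num)
        nlinarith
      calc U (2 ^ (n+1) * x) = U (2 * (2 ^ n * x)) := by congr 1; ring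
        _ ≤ 2 ^ γ * U (2 ^ n * x) := hstep _ hle
        _ ≤ 2 ^ γ * ((2 ^ γ) ^ n * U x) := by gcongr
        _ = _ := by ring
  obtain ⟨n, hn1, hn2⟩ := exists_nat_pow_near hu (by norm_num : (1:ℝ) < 2)
  calc U (u * x) ≤ U (2 ^ (n+1) * x) := hmono (by gcongr)
    _ ≤ (2 ^ γ) ^ (n+1) * U x := hiter _
    _ = (2 ^ γ * (2 ^ n) ^ γ) * U x := by
        rw [pow_succ', ← Real.rpow_natCast (2 ^ γ) n, ← Real.rpow_natCast 2 n, ← Real.rpow_mul (by norm_num), ← Real.rpow_mul (by norm_num), mul_comm γ]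
    _ ≤ _ := by
        have := (hx0 x hx).1
        gcongr

lemma rv_core (U : ℝ → ℝ) (hmono : Monotone U) (hnn : ∀ x, 0 ≤ U x) (α : ℝ) (hα0 : 0 ≤ α) (hα : α < 1)
    (hpos : ∀ᶠ x in atTop, 0 < U x)
    (hrv : ∀ c : ℝ, 0 < c → Tendsto (fun x => U (c * x) / U x) atTop (𝓝 (c ^ α))) :
    ∃ C : ℝ, 0 < C ∧ Tendsto (fun x => (∫ u in Ioi (0:ℝ), U (u * x) * kk u) / U x) atTop (𝓝 C) := by
  set γ := (1 + α) / 2 with hγ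
  have hγα : α < γ := by rw [hγ]; linarith
  have hγ1 : γ < 1 := by rw [hγ]; linarith
  have hγ0 : 0 < γ := by linarith
  set g : ℝ → ℝ := fun u => if u ≤ 1 then 1 else 2 ^ γ * u ^ (γ - 2) with hg
  have hgI : IntegrableOn g (Ioi (0:ℝ)) := by
    rw [← Ioc_union_Ioi_eq_Ioi (zero_le_one (α := ℝ))]
    apply IntegrableOn.union
    · have : IntegrableOn (fun _ : ℝ => (1:ℝ)) (Ioc 0 1) := integrableOn_const (by simp)
      refine this.congr_fun (fun u hu => ?_) measurableSet_Ioc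
      simp [hg, hu.2]
    · have : IntegrableOn (fun u : ℝ => 2 ^ γ * u ^ (γ - 2)) (Ioi 1) :=
        (integrableOn_Ioi_rpow_of_lt (by linarith) one_pos).const_mul _
      refine this.congr_fun (fun u hu => ?_) measurableSet_Ioi
      have : (1:ℝ) < u := hu
      simp [hg, not_le.mpr this]
  have hbase : ∀ u, 0 < u → ∀ r, 0 ≤ r → (u ≤ 1 → r ≤ 1) → (1 ≤ u → r ≤ 2 ^ γ * u ^ γ) → ‖r * kk u‖ ≤ g u := by
    intro u hu r hr h1 h2
    have hk := kk_nonneg u hu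
    rw [Real.norm_eq_abs, abs_of_nonneg (mul_nonneg hr hk)]
    by_cases h : u ≤ 1
    · simp only [hg, h, if_true]
      have := h1 h
      have := kk_le_one u hu
      calc r * kk u ≤ 1 * 1 := by gcongr
        _ = 1 := by ring
    · simp only [hg, h, if_false]
      have := h2 (by linarith)
      calc r * kk u ≤ (2 ^ γ * u ^ γ) * u ^ (-2 : ℝ) := by
            gcongr; exact kk_le u hu
        _ = _ := by rw [mul_assoc, ← Real.rpow_add hu]; rfl
  refine ⟨∫ u in Ioi (0:ℝ), u ^ α * kk u, ?_, ?_⟩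
  · have hI : IntegrableOn (fun u => u ^ α * kk u) (Ioi (0:ℝ)) := by
      refine Integrable.mono' hgI ((by fun_prop : Measurable fun u : ℝ => u ^ α).mul kk_meas).aestronglyMeasurable ?_
      rw [ae_restrict_iff' measurableSet_Ioi]
      refine ae_of_all _ fun u hu => ?_
      have hu : (0:ℝ) < u := hu
      refine hbase u hu _ (by positivity) (fun h => Real.rpow_le_one hu.le h hα0) (fun h => ?_)
      calc u ^ α ≤ u ^ γ := Real.rpow_le_rpow_of_exponent_le h hγα.le
        _ ≤ 2 ^ γ * u ^ γ := le_mul_of_one_le_left (by positivity) (Real.one_le_rpow (by norm_num) hγ0.le)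
    rw [setIntegral_pos_iff_support_of_nonneg_ae ((ae_restrict_iff' measurableSet_Ioi).mpr (ae_of_all _ fun u hu => ?_)) hI]
    · refine lt_of_lt_of_le ?_ (measure_mono (s := Ioi 0) fun u hu => ⟨?_, hu⟩)
      · simp
      · have hu : (0:ℝ) < u := hu
        have := kk_pos u hu
        exact (by positivity : 0 < u ^ α * kk u).ne'
    · have hu : (0:ℝ) < u := hu
      have := kk_nonneg u hu
      show 0 ≤ u ^ α * kk u
      positivity
  · have e : ∀ x, (∫ u in Ioi (0:ℝ), U (u * x) * kk u) / U x = ∫ u in Ioi (0:ℝ), U (u * x) / U x * kk u := by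
      intro x
      rw [← integral_div]
      congr 1; ext u; ring
    simp_rw [e]
    refine tendsto_integral_filter_of_dominated_convergence g ?_ ?_ hgI ?_
    · refine Eventually.of_forall fun x => ?_
      have : Measurable fun u : ℝ => U (u * x) := hmono.measurable.comp (by fun_prop)
      exact ((this.div_const _).mul kk_meas).aestronglyMeasurable
    · filter_upwards [potter U hmono α γ hγ0 hγα hpos hrv, eventually_ge_atTop 0] with x hx hx0
      rw [ae_restrict_iff' measurableSet_Ioi]
      refine ae_of_all _ fun u hu => ?_
      have hu : (0:ℝ) < u := hu
      refine hbase u hu _ (div_nonneg (hnn _) (hnn _)) (fun h => ?_) (fun h => ?_)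
      · rw [div_le_one hx.1]
        exact hmono (by nlinarith)
      · rw [div_le_iff₀ hx.1]
        exact hx.2 u h
    · rw [ae_restrict_iff' measurableSet_Ioi]
      refine ae_of_all _ fun u hu => ?_
      exact (hrv u hu).mul_const _

lemma eta_layer (F : Measure ℝ) [IsFiniteMeasure F] (hF : F (Iic 0) = 0) (s : ℝ) (hs : 0 < s) :
    ∫ x, (1 - Real.exp (-(s * x))) ∂F =
      s * ∫ u in Ioi (0:ℝ), (∫ y in Ioc (0:ℝ) (u * s⁻¹), y ∂F) * kk u := by
  have hae : ∀ᵐ x ∂F, 0 < x := by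
    rw [ae_iff]; simpa [Iic_def] using hF
  set m : Measure ℝ := F.withDensity (fun x => ENNReal.ofReal x) with hm
  have hm0 : m (Iic 0) = 0 := by
    exact (withDensity_absolutelyContinuous F _) hF
  have hUm : ∀ y, m (Iic y) = ENNReal.ofReal (∫ z in Ioc (0:ℝ) y, z ∂F) := by
    intro y
    rw [hm, withDensity_apply _ measurableSet_Iic]
    have h1 : (Iic y : Set ℝ) =ᵐ[F] Ioc 0 y := by
      filter_upwards [hae] with x hx
      have : (x ∈ Iic y) = (x ∈ Ioc 0 y) := by simp [hx]
      exact this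
    rw [setLIntegral_congr h1, ofReal_integral_eq_lintegral_ofReal]
    · refine Measure.integrableOn_of_bounded (M := |y|) (measure_ne_top _ _) (by fun_prop) ?_
      rw [ae_restrict_iff' measurableSet_Ioc]
      refine ae_of_all _ fun x hx => ?_
      rw [Real.norm_eq_abs, abs_of_pos hx.1]
      exact hx.2.trans (le_abs_self _)
    · rw [EventuallyLE, ae_restrict_iff' measurableSet_Ioc]
      exact ae_of_all _ fun x hx => hx.1.le
  have hfub := fubini_layer m hm0 (fun y => ENNReal.ofReal (s ^ 2 * kk (s * y)))
    (fun x => ENNReal.ofReal ((1 - Real.exp (-(s * x))) / x))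
    (by have := kk_meas; fun_prop) (fun x hx => (kk_tail s x hs hx).symm)
  have hL : ∫⁻ x, ENNReal.ofReal ((1 - Real.exp (-(s * x))) / x) ∂m = ENNReal.ofReal (∫ x, (1 - Real.exp (-(s * x))) ∂F) := by
    rw [hm, lintegral_withDensity_eq_lintegral_mul _ (by fun_prop) (by fun_prop), ofReal_integral_eq_lintegral_ofReal]
    · refine lintegral_congr_ae ?_
      filter_upwards [hae] with x hx
      simp only [Pi.mul_apply]
      rw [← ENNReal.ofReal_mul hx.le]
      congr 1; field_simp
    · refine Integrable.of_bound (C := 1) (by fun_prop) ?_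
      filter_upwards [hae] with x hx
      have h1 : Real.exp (-(s*x)) ≤ 1 := by rw [Real.exp_le_one_iff]; nlinarith
      rw [Real.norm_eq_abs, abs_of_nonneg (by linarith)]
      linarith [Real.exp_pos (-(s*x))]
    · filter_upwards [hae] with x hx
      have h1 : Real.exp (-(s*x)) ≤ 1 := by rw [Real.exp_le_one_iff]; nlinarith
      simp only [Pi.zero_apply]; linarith
  rw [hL] at hfub
  have hUnn : ∀ y, 0 ≤ ∫ z in Ioc (0:ℝ) y, z ∂F := fun y =>
    setIntegral_nonneg measurableSet_Ioc fun x hx => hx.1.le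
  have hUmono : Monotone fun y => ∫ z in Ioc (0:ℝ) y, z ∂F := by
    intro a b hab
    have := measure_mono (μ := m) (Iic_subset_Iic.mpr hab)
    rw [hUm, hUm] at this
    exact (ENNReal.ofReal_le_ofReal_iff (hUnn b)).mp this
  have hLnn : 0 ≤ ∫ x, (1 - Real.exp (-(s * x))) ∂F := by
    refine integral_nonneg_of_ae ?_
    filter_upwards [hae] with x hx
    have h1 : Real.exp (-(s*x)) ≤ 1 := by rw [Real.exp_le_one_iff]; nlinarith
    simp only [Pi.zero_apply]; linarith
  have h1 : ∫ x, (1 - Real.exp (-(s * x))) ∂F =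
      ∫ y in Ioi (0:ℝ), (∫ z in Ioc (0:ℝ) y, z ∂F) * (s ^ 2 * kk (s * y)) := by
    symm
    rw [integral_eq_lintegral_of_nonneg_ae]
    · rw [← ENNReal.toReal_ofReal hLnn, hfub]
      congr 1
      refine setLIntegral_congr_fun measurableSet_Ioi fun y hy => ?_
      rw [hUm, ENNReal.ofReal_mul (hUnn y)]
    · rw [EventuallyLE, ae_restrict_iff' measurableSet_Ioi]
      refine ae_of_all _ fun y hy => ?_
      have hy : (0:ℝ) < y := hy
      exact mul_nonneg (hUnn y) (mul_nonneg (by positivity) (kk_nonneg _ (by positivity)))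
    · exact (hUmono.measurable.mul ((kk_meas.comp (measurable_const_mul s)).const_mul _)).aestronglyMeasurable
  rw [h1]
  have h2 := integral_comp_mul_left_Ioi (fun u => (∫ z in Ioc (0:ℝ) (u * s⁻¹), z ∂F) * (s ^ 2 * kk u)) 0 hs
  simp only [mul_zero, smul_eq_mul] at h2
  have h3 : ∀ y, s * y * s⁻¹ = y := fun y => by field_simp
  simp_rw [h3] at h2
  rw [h2, ← integral_const_mul, ← integral_const_mul]
  congr 1; ext u; field_simp

lemma eta_rv (F : Measure ℝ) [IsFiniteMeasure F] (hF : F (Iic 0) = 0) (α : ℝ) (hα0 : 0 ≤ α) (hα : α < 1)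
    (hpos : ∀ᶠ x in atTop, 0 < ∫ y in Ioc (0:ℝ) x, y ∂F)
    (hrv : ∀ c : ℝ, 0 < c → Tendsto (fun x => (∫ y in Ioc (0:ℝ) (c * x), y ∂F) / ∫ y in Ioc (0:ℝ) x, y ∂F) atTop (𝓝 (c ^ α)))
    (θ : ℝ) (hθ : 0 < θ) :
    Tendsto (fun b => (∫ x, (1 - Real.exp (-((b * θ) * x))) ∂F) / ∫ x, (1 - Real.exp (-(b * x))) ∂F)
      (𝓝[>] 0) (𝓝 (θ ^ (1 - α))) := by
  set U : ℝ → ℝ := fun x => ∫ y in Ioc (0:ℝ) x, y ∂F with hU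
  have hUnn : ∀ y, 0 ≤ U y := fun y =>
    setIntegral_nonneg measurableSet_Ioc fun x hx => hx.1.le
  have hUmono : Monotone U := by
    intro a b hab
    refine setIntegral_mono_set ?_ ?_ (Eventually.of_forall fun x hx => ⟨hx.1, hx.2.trans hab⟩)
    · refine Measure.integrableOn_of_bounded (M := |b|) (measure_ne_top _ _) (by fun_prop) ?_
      rw [ae_restrict_iff' measurableSet_Ioc]
      refine ae_of_all _ fun x hx => ?_
      rw [Real.norm_eq_abs, abs_of_pos hx.1]
      exact hx.2.trans (le_abs_self _)
    · rw [EventuallyLE, ae_restrict_iff' measurableSet_Ioc]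
      exact ae_of_all _ fun x hx => hx.1.le
  obtain ⟨C, hC, hlim⟩ := rv_core U hUmono hUnn α hα0 hα hpos hrv
  set W : ℝ → ℝ := fun x => ∫ u in Ioi (0:ℝ), U (u * x) * kk u with hW
  have hWrv : Tendsto (fun x => W (θ⁻¹ * x) / W x) atTop (𝓝 ((θ⁻¹) ^ α)) := by
    have hx := tendsto_id.const_mul_atTop (inv_pos.mpr hθ) (α := ℝ) (l := atTop)
    have h1 := ((hlim.comp hx).div hlim hC.ne').mul (hrv θ⁻¹ (by positivity))
    rw [div_self hC.ne', one_mul] at h1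
    refine h1.congr' ?_
    filter_upwards [hpos, hx.eventually hpos] with x h2 h3
    simp only [Function.comp, id, Pi.div_apply] at *
    change 0 < U x at h2
    change 0 < U (θ⁻¹ * x) at h3
    change (W (θ⁻¹ * x) / U (θ⁻¹ * x)) / (W x / U x) * (U (θ⁻¹ * x) / U x) = _
    have h3' := h3.ne'
    have h2' := h2.ne'
    generalize U (θ⁻¹ * x) = a at *
    generalize W (θ⁻¹ * x) = d at *
    by_cases hWx : W x = 0
    · simp [hWx]
    · field_simp
  have h4 := (hWrv.comp tendsto_inv_nhdsGT_zero).const_mul θ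
  have hval : θ * (θ⁻¹) ^ α = θ ^ (1 - α) := by
    rw [Real.inv_rpow hθ.le, Real.rpow_sub hθ, Real.rpow_one]; rfl
  rw [hval] at h4
  refine h4.congr' ?_
  filter_upwards [self_mem_nhdsWithin] with b hb
  have hb : (0:ℝ) < b := hb
  rw [eta_layer F hF b hb, eta_layer F hF (b * θ) (by positivity)]
  change θ * (W (θ⁻¹ * b⁻¹) / W b⁻¹) = (b * θ * W ((b * θ)⁻¹)) / (b * W (b⁻¹))
  rw [mul_inv, mul_comm b⁻¹ θ⁻¹]
  by_cases hWx : W b⁻¹ = 0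
  · simp [hWx]
  · field_simp

lemma ae_pos_of_Iic (μ : Measure ℝ) (hμ : μ (Iic 0) = 0) : ∀ᵐ x ∂μ, 0 < x := by
  rw [ae_iff]; simpa [Iic_def] using hμ

lemma laplace_deriv (μ : Measure ℝ) (hμ : μ (Iic 0) = 0)
    (hint : ∀ s : ℝ, 0 < s → Integrable (fun x => (1 - Real.exp (-(s * x))) * x) μ) (s : ℝ) (hs : 0 < s) :
    Integrable (fun x => Real.exp (-(s * x)) * x ^ 2) μ ∧
    HasDerivAt (fun s => ∫ x, (1 - Real.exp (-(s * x))) * x ∂μ) (∫ x, Real.exp (-(s * x)) * x ^ 2 ∂μ) s := by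
  have hae := ae_pos_of_Iic μ hμ
  refine hasDerivAt_integral_of_dominated_loc_of_deriv_le (s := Ioi (s / 2))
    (F := fun s x => (1 - Real.exp (-(s * x))) * x) (F' := fun s x => Real.exp (-(s * x)) * x ^ 2)
    (bound := fun x => (s / 2)⁻¹ * ((1 - Real.exp (-(s / 2 * x))) * x)) (Ioi_mem_nhds (by linarith)) ?_ (hint s hs) ?_ ?_ ?_ ?_
  · exact Eventually.of_forall fun s => by fun_prop
  · fun_prop
  · filter_upwards [hae] with x hx r hr
    have hr : s / 2 < r := hr
    rw [Real.norm_eq_abs, abs_of_nonneg (by positivity)]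
    have h1 : Real.exp (-(r * x)) ≤ Real.exp (-(s / 2 * x)) := by
      rw [Real.exp_le_exp]; nlinarith
    have h2 : (s / 2 * x) * Real.exp (-(s / 2 * x)) ≤ 1 - Real.exp (-(s / 2 * x)) := by
      have h3 := Real.add_one_le_exp (s / 2 * x)
      have h4 : Real.exp (s / 2 * x) * Real.exp (-(s / 2 * x)) = 1 := by rw [← Real.exp_add]; simp
      nlinarith [Real.exp_pos (-(s / 2 * x))]
    calc Real.exp (-(r * x)) * x ^ 2 ≤ Real.exp (-(s / 2 * x)) * x ^ 2 := by gcongr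
      _ = (s / 2)⁻¹ * (((s / 2 * x) * Real.exp (-(s / 2 * x))) * x) := by field_simp
      _ ≤ _ := by gcongr
  · exact (hint (s / 2) (by positivity)).const_mul _
  · filter_upwards [hae] with x hx r hr
    have h1 : HasDerivAt (fun s : ℝ => Real.exp (-(s * x))) (Real.exp (-(r * x)) * (-(1 * x))) r :=
      (((hasDerivAt_id r).mul_const x).neg).exp
    have h2 := (h1.const_sub 1).mul_const x
    convert! h2 using 1
    ring

lemma eta_facts (F : Measure ℝ) [IsProbabilityMeasure F] (hF : F (Iic 0) = 0) (η : ℝ → ℝ)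
    (hη : ∀ s, η s = ∫ x, (1 - Real.exp (-(s * x))) ∂F) :
    η 0 = 0 ∧ StrictMonoOn η (Ici 0) ∧ ContinuousOn η (Ici 0) ∧ Tendsto η atTop (𝓝 1) := by
  have hae := ae_pos_of_Iic F hF
  have hb : ∀ s, 0 ≤ s → ∀ x, 0 < x → ‖1 - Real.exp (-(s * x))‖ ≤ 1 := by
    intro s hs x hx
    have h1 : Real.exp (-(s*x)) ≤ 1 := by rw [Real.exp_le_one_iff]; have := mul_nonneg hs hx.le; linarith
    rw [Real.norm_eq_abs, abs_of_nonneg (by linarith)]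
    linarith [Real.exp_pos (-(s*x))]
  have hi : ∀ s, 0 ≤ s → Integrable (fun x => 1 - Real.exp (-(s * x))) F := by
    intro s hs
    refine Integrable.of_bound (C := 1) (by fun_prop) ?_
    filter_upwards [hae] with x hx using hb s hs x hx
  obtain rfl : η = fun s => ∫ x, (1 - Real.exp (-(s * x))) ∂F := funext hη
  refine ⟨by simp, ?_, ?_, ?_⟩
  · intro a ha c hc hac
    have ha : 0 ≤ a := ha
    have hc : 0 ≤ c := hc
    have hlt : ∀ x, 0 < x → 1 - Real.exp (-(a * x)) < 1 - Real.exp (-(c * x)) := by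
      intro x hx
      have : Real.exp (-(c * x)) < Real.exp (-(a * x)) := by
        rw [Real.exp_lt_exp]; nlinarith
      linarith
    simp only
    rw [← sub_pos, ← integral_sub (hi c hc) (hi a ha)]
    refine (integral_pos_iff_support_of_nonneg_ae ?_ ((hi c hc).sub (hi a ha))).mpr ?_
    rotate_left
    · have h1 : F (Function.support ((fun x => 1 - Real.exp (-(c * x))) - (fun x => 1 - Real.exp (-(a * x))))) = F univ := by
        refine measure_congr ?_
        rw [eventuallyEq_univ]
        filter_upwards [hae] with x hx
        exact (sub_pos.mpr (hlt x hx)).ne'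
      rw [h1]; simp
    · filter_upwards [hae] with x hx using (sub_pos.mpr (hlt x hx)).le
  · refine continuousOn_of_dominated (bound := fun _ => 1) ?_ ?_ (integrable_const _) ?_
    · intro s _; fun_prop
    · intro s hs
      filter_upwards [hae] with x hx using hb s hs x hx
    · exact ae_of_all _ fun x => by fun_prop
  · suffices h : Tendsto (fun s => ∫ x, (1 - Real.exp (-(s * x))) ∂F) atTop (𝓝 (∫ x, (1:ℝ) ∂F)) by simpa using h
    refine tendsto_integral_filter_of_dominated_convergence (fun _ => 1) ?_ ?_ (integrable_const _) ?_
    · exact Eventually.of_forall fun s => by fun_prop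
    · filter_upwards [eventually_ge_atTop 0] with s hs
      filter_upwards [hae] with x hx using hb s hs x hx
    · filter_upwards [hae] with x hx
      have h3 : Tendsto (fun y : ℝ => Real.exp (-(y * x))) atTop (𝓝 0) :=
        Real.tendsto_exp_neg_atTop_nhds_zero.comp (tendsto_id.atTop_mul_const hx)
      simpa using h3.const_sub 1

lemma psi_facts (ν₀ : Measure ℝ) (hν₀supp : ν₀ (Iic 0) = 0)
    (hmom : ∫⁻ x, ENNReal.ofReal (x ^ 2) ∂ν₀ = 1)
    (ψ₀ : ℝ → ℝ) (hψ₀ : ∀ s : ℝ, ψ₀ s = ∫ x, (1 - Real.exp (-(s * x))) * x ∂ν₀) (F : Measure ℝ)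
    (hFdef : F = ν₀.withDensity (fun x => ENNReal.ofReal (x ^ 2))) (η : ℝ → ℝ)
    (hη : ∀ s, η s = ∫ x, (1 - Real.exp (-(s * x))) ∂F) :
    IsProbabilityMeasure F ∧ F (Iic 0) = 0 ∧ (∀ s, 0 < s → HasDerivAt ψ₀ (1 - η s) s) ∧ (∀ s, 0 < s → ψ₀ s ≤ s) ∧
      (∀ s, 0 < s → 0 < ψ₀ s) ∧ (∀ s, 0 < s → ψ₀ s = s - ∫ u in (0:ℝ)..s, η u) := by
  have hae := ae_pos_of_Iic ν₀ hν₀supp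
  have hP : IsProbabilityMeasure F := by
    refine ⟨?_⟩
    rw [hFdef, withDensity_apply _ MeasurableSet.univ, Measure.restrict_univ, hmom]
  have hF0 : F (Iic 0) = 0 := by
    rw [hFdef]; exact (withDensity_absolutelyContinuous ν₀ _) hν₀supp
  have hx2 : Integrable (fun x : ℝ => x ^ 2) ν₀ := by
    refine ⟨by fun_prop, ?_⟩
    rw [hasFiniteIntegral_iff_ofReal (ae_of_all _ fun x => by positivity), hmom]
    exact ENNReal.one_lt_top
  have hx2v : ∫ x, x ^ 2 ∂ν₀ = 1 := by
    rw [integral_eq_lintegral_of_nonneg_ae (ae_of_all _ fun x => by positivity) (by fun_prop), hmom]; simp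
  have hbd : ∀ s, 0 ≤ s → ∀ x, 0 < x → 0 ≤ (1 - Real.exp (-(s * x))) * x ∧ (1 - Real.exp (-(s * x))) * x ≤ s * x ^ 2 := by
    intro s hs x hx
    have h1 : Real.exp (-(s*x)) ≤ 1 := by rw [Real.exp_le_one_iff]; have := mul_nonneg hs hx.le; linarith
    have h2 := Real.add_one_le_exp (-(s*x))
    constructor
    · exact mul_nonneg (by linarith) hx.le
    · nlinarith
  have hint : ∀ s : ℝ, 0 ≤ s → Integrable (fun x => (1 - Real.exp (-(s * x))) * x) ν₀ := by
    intro s hs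
    refine (hx2.const_mul s).mono' (by fun_prop) ?_
    filter_upwards [hae] with x hx
    have := hbd s hs x hx
    rw [Real.norm_eq_abs, abs_of_nonneg this.1]; exact this.2
  have hle : ∀ s, 0 ≤ s → ψ₀ s ≤ s := by
    intro s hs
    rw [hψ₀]
    have : s = ∫ x, s * x ^ 2 ∂ν₀ := by rw [integral_const_mul, hx2v, mul_one]
    conv_rhs => rw [this]
    refine integral_mono_ae (hint s hs) (hx2.const_mul s) ?_
    filter_upwards [hae] with x hx using (hbd s hs x hx).2
  have hnn : ∀ s, 0 ≤ s → 0 ≤ ψ₀ s := by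
    intro s hs
    rw [hψ₀]
    refine integral_nonneg_of_ae ?_
    filter_upwards [hae] with x hx using (hbd s hs x hx).1
  have hψz : ψ₀ 0 = 0 := by rw [hψ₀]; simp
  obtain ⟨h0, hm, hc, ht⟩ := eta_facts F hF0 η hη
  have hder : ∀ s, 0 < s → HasDerivAt ψ₀ (1 - η s) s := by
    intro s hs
    have h1 := (laplace_deriv ν₀ hν₀supp (fun s hs => hint s hs.le) s hs).2
    have h2 : ψ₀ = fun s => ∫ x, (1 - Real.exp (-(s * x))) * x ∂ν₀ := funext hψ₀
    rw [← h2] at h1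
    convert! h1 using 1
    have h3 : ∫ x, Real.exp (-(s * x)) * x ^ 2 ∂ν₀ = ∫ x, Real.exp (-(s * x)) ∂F := by
      rw [hFdef, integral_withDensity_eq_integral_toReal_smul (by fun_prop) (ae_of_all _ fun x => ENNReal.ofReal_lt_top)]
      refine integral_congr_ae (ae_of_all _ fun x => ?_)
      simp only [smul_eq_mul]
      rw [ENNReal.toReal_ofReal (by positivity)]; ring
    have hi : Integrable (fun x => Real.exp (-(s * x))) F := by
      refine Integrable.of_bound (C := 1) (by fun_prop) ?_
      filter_upwards [ae_pos_of_Iic F hF0] with x hx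
      rw [Real.norm_eq_abs, abs_of_pos (Real.exp_pos _), Real.exp_le_one_iff]
      have := mul_pos hs hx; linarith
    rw [h3, hη, integral_sub (integrable_const _) hi]
    simp
  have hlt1 : ∀ s, 0 ≤ s → η s < 1 := by
    intro s hs
    have h1 : η s < η (s + 1) := hm hs (by rw [mem_Ici]; linarith) (by linarith)
    refine lt_of_lt_of_le h1 (ge_of_tendsto ht ?_)
    filter_upwards [eventually_ge_atTop (s + 1)] with r hr
    exact hm.monotoneOn (by rw [mem_Ici]; linarith) (by rw [mem_Ici]; linarith) hr
  have hψc : ContinuousOn ψ₀ (Ici 0) := by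
    intro s hs
    rcases eq_or_lt_of_le (show (0:ℝ) ≤ s from hs) with h | h
    · subst h
      unfold ContinuousWithinAt
      rw [hψz]
      refine tendsto_of_tendsto_of_tendsto_of_le_of_le' (g := fun _ => 0) (h := fun s => s) tendsto_const_nhds nhdsWithin_le_nhds ?_ ?_
      · filter_upwards [self_mem_nhdsWithin] with r hr using hnn r hr
      · filter_upwards [self_mem_nhdsWithin] with r hr using hle r hr
    · exact (hder s h).continuousAt.continuousWithinAt
  refine ⟨hP, hF0, hder, fun s hs => hle s hs.le, ?_, ?_⟩
  · have hsm : StrictMonoOn ψ₀ (Ici 0) := by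
      refine strictMonoOn_of_deriv_pos (convex_Ici 0) hψc ?_
      intro s hs
      rw [interior_Ici] at hs
      have hs : 0 < s := hs
      rw [(hder s hs).deriv]
      linarith [hlt1 s hs.le]
    intro s hs
    rw [← hψz]
    exact hsm (by simp) hs.le hs
  · intro s hs
    have h1 := intervalIntegral.integral_eq_sub_of_hasDerivAt_of_le (f := fun u => u - ψ₀ u) (f' := η) hs.le
      (continuousOn_id.sub (hψc.mono Icc_subset_Ici_self)) ?_ ?_
    · rw [h1, hψz]; ring
    · intro u hu
      have := (hasDerivAt_id u).sub (hder u hu.1)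
      convert! this using 1
      ring
    · refine ContinuousOn.intervalIntegrable ?_
      rw [uIcc_of_le hs.le]
      exact hc.mono Icc_subset_Ici_self

lemma sol_facts (μ : Measure ℝ) (hμ : μ (Iic 0) = 0) (t : ℝ) (ht : t ∈ Ico (0:ℝ) 1) (ψ₀ η : ℝ → ℝ)
    (hder : ∀ s, 0 < s → HasDerivAt ψ₀ (1 - η s) s) (hle : ∀ s, 0 < s → ψ₀ s ≤ s)
    (hpos : ∀ s, 0 < s → 0 < ψ₀ s) (h0 : η 0 = 0) (hm : StrictMonoOn η (Ici 0)) (hc : ContinuousOn η (Ici 0))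
    (σ : ℝ → ℝ) (hσ : ∀ s, 0 < s → 0 < σ s ∧ s = σ s - t * ψ₀ (σ s))
    (hsol : ∀ s, 0 < s → ∫ x, (1 - Real.exp (-(s * x))) * x ∂μ = ψ₀ (σ s)) :
    Integrable (fun x : ℝ => x ^ 2) μ ∧ ∫ x, x ^ 2 ∂μ = (1 - t)⁻¹ ∧
    ∀ θ, 0 < θ → ∫ x, Real.exp (-((θ - t * ψ₀ θ) * x)) * x ^ 2 ∂μ = (1 - η θ) / ((1 - t) + t * η θ) := by
  have h1t : 0 < 1 - t := by linarith [ht.2]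
  have ht0 := ht.1
  have hae := ae_pos_of_Iic μ hμ
  have hηpos : ∀ s, 0 < s → 0 < η s := by
    intro s hs
    rw [← h0]; exact hm (by simp) hs.le hs
  have hsd : ∀ θ, 0 < θ → HasDerivAt (fun θ => θ - t * ψ₀ θ) ((1 - t) + t * η θ) θ := by
    intro θ hθ
    have := (hasDerivAt_id θ).sub ((hder θ hθ).const_mul t)
    convert! this using 1
    ring
  have hsm : StrictMonoOn (fun θ => θ - t * ψ₀ θ) (Ioi 0) := by
    refine strictMonoOn_of_deriv_pos (convex_Ioi 0) (fun θ hθ => (hsd θ hθ).continuousAt.continuousWithinAt) ?_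
    intro s hs
    rw [interior_Ioi] at hs
    have hs : 0 < s := hs
    rw [(hsd s hs).deriv]
    have := hηpos s hs
    positivity
  have hsp : ∀ θ, 0 < θ → 0 < θ - t * ψ₀ θ := by
    intro θ hθ
    have := hle θ hθ
    nlinarith
  have hcomp : ∀ θ, 0 < θ → ∫ x, (1 - Real.exp (-((θ - t * ψ₀ θ) * x))) * x ∂μ = ψ₀ θ := by
    intro θ hθ
    rw [hsol _ (hsp θ hθ)]
    have := hσ _ (hsp θ hθ)
    congr 1
    exact hsm.injOn this.1 hθ this.2.symm
  have hint : ∀ s : ℝ, 0 < s → Integrable (fun x => (1 - Real.exp (-(s * x))) * x) μ := by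
    intro s hs
    refine Integrable.of_integral_ne_zero ?_
    rw [hsol s hs]
    exact (hpos _ (hσ s hs).1).ne'
  have hL : ∀ θ, 0 < θ → ∫ x, Real.exp (-((θ - t * ψ₀ θ) * x)) * x ^ 2 ∂μ = (1 - η θ) / ((1 - t) + t * η θ) := by
    intro θ hθ
    have h1 := (laplace_deriv μ hμ hint _ (hsp θ hθ)).2
    have h2 := h1.comp θ (hsd θ hθ)
    have h3 : HasDerivAt ψ₀ ((∫ x, Real.exp (-((θ - t * ψ₀ θ) * x)) * x ^ 2 ∂μ) * ((1 - t) + t * η θ)) θ := by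
      refine h2.congr_of_eventuallyEq ?_
      filter_upwards [lt_mem_nhds hθ] with r hr
      exact (hcomp r hr).symm
    have h4 := h3.unique (hder θ hθ)
    have := hηpos θ hθ
    rw [eq_div_iff (by positivity)]
    exact h4
  have hu : Tendsto (fun n : ℕ => 1 / ((n:ℝ) + 1)) atTop (𝓝 0) := tendsto_one_div_add_atTop_nhds_zero_nat
  have hup : ∀ n : ℕ, 0 < 1 / ((n:ℝ) + 1) := fun n => by positivity
  set S : ℕ → ℝ := fun n => 1 / ((n:ℝ) + 1) - t * ψ₀ (1 / ((n:ℝ) + 1)) with hS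
  have hS0 : Tendsto S atTop (𝓝 0) := by
    refine tendsto_of_tendsto_of_tendsto_of_le_of_le tendsto_const_nhds hu (fun n => (hsp _ (hup n)).le) (fun n => ?_)
    have := hpos _ (hup n)
    simp only [hS]
    have := mul_nonneg ht0 this.le
    linarith
  have hSanti : Antitone S := by
    intro n m hnm
    refine hsm.monotoneOn (hup m) (hup n) ?_
    gcongr
  have hT := lintegral_tendsto_of_tendsto_of_monotone (μ := μ)
    (f := fun n x => ENNReal.ofReal (Real.exp (-(S n * x)) * x ^ 2)) (F := fun x => ENNReal.ofReal (x ^ 2)) ?_ ?_ ?_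
  rotate_left
  · intro n; fun_prop
  · filter_upwards [hae] with x hx n m hnm
    refine ENNReal.ofReal_le_ofReal ?_
    have := hSanti hnm
    gcongr
  · refine ae_of_all _ fun x => ?_
    have h1 : Tendsto (fun n => Real.exp (-(S n * x)) * x ^ 2) atTop (𝓝 (Real.exp (-(0 * x)) * x ^ 2)) :=
      ((Real.continuous_exp.tendsto _).comp (hS0.mul_const x).neg).mul_const _
    simp only [zero_mul, neg_zero, Real.exp_zero, one_mul] at h1
    exact (ENNReal.continuous_ofReal.tendsto _).comp h1
  have hval : ∀ n, ∫⁻ x, ENNReal.ofReal (Real.exp (-(S n * x)) * x ^ 2) ∂μ =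
      ENNReal.ofReal ((1 - η (1 / ((n:ℝ) + 1))) / ((1 - t) + t * η (1 / ((n:ℝ) + 1)))) := by
    intro n
    rw [← hL _ (hup n), ofReal_integral_eq_lintegral_ofReal (laplace_deriv μ hμ hint _ (hsp _ (hup n))).1 (ae_of_all _ fun x => by positivity)]
  simp_rw [hval] at hT
  have hη0 : Tendsto (fun n : ℕ => η (1 / ((n:ℝ) + 1))) atTop (𝓝 0) := by
    have h1 : Tendsto η (𝓝[Ici 0] 0) (𝓝 (η 0)) := hc 0 (by simp)
    rw [h0] at h1
    exact h1.comp (tendsto_nhdsWithin_iff.mpr ⟨hu, Eventually.of_forall fun n => (hup n).le⟩)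
  have hlim : Tendsto (fun n : ℕ => ENNReal.ofReal ((1 - η (1 / ((n:ℝ) + 1))) / ((1 - t) + t * η (1 / ((n:ℝ) + 1))))) atTop
      (𝓝 (ENNReal.ofReal ((1 - t)⁻¹))) := by
    refine (ENNReal.continuous_ofReal.tendsto _).comp ?_
    have := (hη0.const_sub 1).div ((hη0.const_mul t).const_add (1 - t)) (by rw [mul_zero, add_zero]; exact h1t.ne')
    rw [mul_zero, add_zero, sub_zero, one_div] at this
    exact this
  have hfin := tendsto_nhds_unique hT hlim
  refine ⟨⟨by fun_prop, ?_⟩, ?_, hL⟩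
  · rw [hasFiniteIntegral_iff_ofReal (ae_of_all _ fun x => by positivity), hfin]
    exact ENNReal.ofReal_lt_top
  · rw [integral_eq_lintegral_of_nonneg_ae (ae_of_all _ fun x => by positivity) (by fun_prop), hfin,
      ENNReal.toReal_ofReal (by positivity)]

lemma lap_layer (m : Measure ℝ) [IsFiniteMeasure m] (hm : m (Iic 0) = 0) (s : ℝ) (hs : 0 < s) :
    ∫ y in Ioi (0:ℝ), Real.exp (-(s * y)) * m.real (Iic y) = s⁻¹ * ∫ x, Real.exp (-(s * x)) ∂m := by
  have htail : ∀ x, 0 < x → ENNReal.ofReal (s⁻¹ * Real.exp (-(s * x))) = ∫⁻ y in Ici x, ENNReal.ofReal (Real.exp (-(s * y))) := by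
    intro x hx
    have h1 : IntegrableOn (fun y => Real.exp (-(s * y))) (Ioi x) := by
      simpa [neg_mul] using integrableOn_exp_mul_Ioi (neg_lt_zero.mpr hs) x
    have h2 : ∫ y in Ioi x, Real.exp (-(s * y)) = s⁻¹ * Real.exp (-(s * x)) := by
      have := integral_exp_mul_Ioi (neg_lt_zero.mpr hs) x
      simp only [neg_mul] at this
      rw [this]; field_simp
    rw [setLIntegral_congr Ioi_ae_eq_Ici.symm, ← ofReal_integral_eq_lintegral_ofReal h1 (ae_of_all _ fun x => (Real.exp_pos _).le), h2]
  have hfub := fubini_layer m hm (fun y => ENNReal.ofReal (Real.exp (-(s * y)))) _ (by fun_prop) htail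
  have hmm : Measurable fun y => m.real (Iic y) := by
    have : Monotone fun y => m.real (Iic y) := fun a b hab => measureReal_mono (Iic_subset_Iic.mpr hab)
    exact this.measurable
  rw [← integral_const_mul, integral_eq_lintegral_of_nonneg_ae (ae_of_all _ fun y => by positivity)
    (by fun_prop), integral_eq_lintegral_of_nonneg_ae (ae_of_all _ fun y => by positivity) (by fun_prop), hfub]
  congr 1
  refine lintegral_congr fun y => ?_
  rw [ENNReal.ofReal_mul (Real.exp_pos _).le, ofReal_measureReal, mul_comm]

lemma I_scaling (η : ℝ → ℝ) (hmono : StrictMonoOn η (Ici 0)) (hcont : ContinuousOn η (Ici 0)) (h0 : η 0 = 0)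
    (ρ : ℝ) (hρ : 0 < ρ)
    (hrv : ∀ θ, 0 < θ → Tendsto (fun b => η (b * θ) / η b) (𝓝[>] 0) (𝓝 (θ ^ ρ)))
    (φ : ℝ) (hφ : 0 < φ) :
    Tendsto (fun b => (∫ u in (0:ℝ)..(b * φ), η u) / (b * η b)) (𝓝[>] 0) (𝓝 (φ ^ (1 + ρ) / (1 + ρ))) := by
  have hpos : ∀ s, 0 < s → 0 < η s := by
    intro s hs
    rw [← h0]; exact hmono (by simp) hs.le hs
  have hlimval : ∫ u in (0:ℝ)..φ, u ^ ρ = φ ^ (1 + ρ) / (1 + ρ) := by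
    rw [integral_rpow (Or.inl (by linarith)), Real.zero_rpow (by linarith), sub_zero, add_comm ρ 1]
  rw [← hlimval]
  have hD : Tendsto (fun b => ∫ u in (0:ℝ)..φ, η (b * u) / η b) (𝓝[>] 0) (𝓝 (∫ u in (0:ℝ)..φ, u ^ ρ)) := by
    refine intervalIntegral.tendsto_integral_filter_of_dominated_convergence (fun _ => φ ^ ρ + 1) ?_ ?_ ?_ ?_
    · filter_upwards [self_mem_nhdsWithin] with b hb
      have hb : (0:ℝ) < b := hb
      refine ContinuousOn.aestronglyMeasurable ?_ measurableSet_uIoc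
      refine ContinuousOn.div_const ?_ _
      refine hcont.comp (by fun_prop) ?_
      intro u hu
      rw [uIoc_of_le hφ.le] at hu
      exact mul_nonneg hb.le hu.1.le
    · have := (hrv φ hφ).eventually_lt_const (by linarith : φ ^ ρ < φ ^ ρ + 1)
      filter_upwards [self_mem_nhdsWithin, this] with b hb hlt
      have hb : (0:ℝ) < b := hb
      refine ae_of_all _ fun u hu => ?_
      rw [uIoc_of_le hφ.le] at hu
      have h1 := hpos b hb
      have h2 := hpos (b * u) (mul_pos hb hu.1)
      rw [Real.norm_eq_abs, abs_of_pos (by positivity)]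
      refine le_trans ?_ hlt.le
      gcongr
      exact hmono.monotoneOn (mul_pos hb hu.1).le (mul_pos hb hφ).le (by gcongr; exact hu.2)
    · exact intervalIntegrable_const
    · refine ae_of_all _ fun u hu => ?_
      rw [uIoc_of_le hφ.le] at hu
      exact hrv u hu.1
  refine hD.congr' ?_
  filter_upwards [self_mem_nhdsWithin] with b hb
  have hb : (0:ℝ) < b := hb
  have h1 := intervalIntegral.mul_integral_comp_mul_left (f := η) (a := 0) (b := φ) b
  rw [mul_zero] at h1
  rw [intervalIntegral.integral_div, ← h1]
  have := (hpos b hb).ne'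
  field_simp

lemma scaling (η : ℝ → ℝ) (hmono : StrictMonoOn η (Ici 0)) (hcont : ContinuousOn η (Ici 0)) (h0 : η 0 = 0)
    (htop : Tendsto η atTop (𝓝 1)) (ρ : ℝ) (hρ : 0 < ρ)
    (hrv : ∀ θ, 0 < θ → Tendsto (fun b => η (b * θ) / η b) (𝓝[>] 0) (𝓝 (θ ^ ρ)))
    (ψ : ℝ → ℝ) (hψ : ∀ θ, 0 < θ → ψ θ = θ - ∫ u in (0:ℝ)..θ, η u)
    (ℒ : ℝ → ℝ → ℝ) (hanti : ∀ t ∈ Ico (0:ℝ) 1, AntitoneOn (ℒ t) (Ioi 0))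
    (hℒ : ∀ t ∈ Ico (0:ℝ) 1, ∀ θ, 0 < θ → ℒ t (θ - t * ψ θ) = (1 - t) * (1 - η θ) / ((1 - t) + t * η θ)) :
    ∃ lam : ℝ → ℝ, StrictMonoOn lam (Ico 0 1) ∧ (∀ t ∈ Ico (0:ℝ) 1, 0 < lam t) ∧
      Tendsto lam (𝓝[<] (1:ℝ)) atTop ∧
      ∀ θ, 0 < θ → Tendsto (fun t => ℒ t ((θ + θ ^ (1 + ρ)) / lam t)) (𝓝[<] (1:ℝ))
        (𝓝 (1 / (1 + (1 + ρ) * θ ^ ρ))) := by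
  have hpos : ∀ s, 0 < s → 0 < η s := by
    intro s hs
    rw [← h0]; exact hmono (by simp) hs.le hs
  have hex : ∀ t : ℝ, ∃ b, t ∈ Ico (0:ℝ) 1 → 0 < b ∧ η b = (1 - t) / 2 := by
    intro t
    by_cases ht : t ∈ Ico (0:ℝ) 1
    · obtain ⟨M, hM1, hM2⟩ := ((htop.eventually_const_lt (by norm_num : (1/2:ℝ) < 1)).and (eventually_gt_atTop 0)).exists
      have := intermediate_value_Icc hM2.le (hcont.mono Icc_subset_Ici_self)
      have hm : (1 - t) / 2 ∈ Icc (η 0) (η M) := by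
        rw [h0]; constructor <;> linarith [ht.1, ht.2]
      obtain ⟨b, hb, hb2⟩ := this hm
      refine ⟨b, fun _ => ⟨lt_of_le_of_ne hb.1 ?_, hb2⟩⟩
      rintro rfl
      rw [h0] at hb2
      linarith [ht.2]
    · exact ⟨0, fun h => absurd h ht⟩
  choose b hb using hex
  have hbanti : ∀ t ∈ Ico (0:ℝ) 1, ∀ t' ∈ Ico (0:ℝ) 1, t < t' → b t' < b t := by
    intro t ht t' ht' htt
    have h1 := hb t ht
    have h2 := hb t' ht'
    by_contra hcon
    have := hmono.monotoneOn h1.1.le h2.1.le (not_lt.mp hcon)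
    rw [h1.2, h2.2] at this
    linarith
  have hIco : ∀ᶠ t in 𝓝[<] (1:ℝ), t ∈ Ico (0:ℝ) 1 := by
    filter_upwards [self_mem_nhdsWithin, nhdsWithin_le_nhds (Ici_mem_nhds (by norm_num : (0:ℝ) < 1))] with t h1 h2
    exact ⟨h2, h1⟩
  have hid : Tendsto (fun t : ℝ => t) (𝓝[<] (1:ℝ)) (𝓝 1) := nhdsWithin_le_nhds
  have hb0 : Tendsto b (𝓝[<] (1:ℝ)) (𝓝[>] 0) := by
    rw [tendsto_nhdsWithin_iff]
    refine ⟨?_, by filter_upwards [hIco] with t ht; exact (hb t ht).1⟩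
    rw [tendsto_order]
    refine ⟨fun a ha => ?_, fun a ha => ?_⟩
    · filter_upwards [hIco] with t ht
      exact ha.trans (hb t ht).1
    · have h1 : Tendsto (fun t : ℝ => (1 - t) / 2) (𝓝[<] (1:ℝ)) (𝓝 ((1 - 1) / 2)) := (hid.const_sub 1).div_const 2
      have h2 := h1.eventually_lt_const (by simpa using hpos a ha : (1 - 1) / 2 < η a)
      filter_upwards [hIco, h2] with t ht h3
      rw [← (hb t ht).2] at h3
      exact (hmono.lt_iff_lt (hb t ht).1.le ha.le).mp h3
  set κ : ℝ := (2 * (1 + ρ)) ^ (1 / ρ) with hκ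
  have hκ0 : 0 < κ := by positivity
  have hκρ : κ ^ ρ = 2 * (1 + ρ) := by
    rw [hκ, ← Real.rpow_mul (by positivity), one_div, inv_mul_cancel₀ hρ.ne', Real.rpow_one]
  have hpos' : ∀ t ∈ Ico (0:ℝ) 1, 0 < (1 - t) * (κ * b t) := by
    intro t ht
    have := (hb t ht).1
    have : 0 < 1 - t := by linarith [ht.2]
    positivity
  refine ⟨fun t => ((1 - t) * (κ * b t))⁻¹, ?_, ?_, ?_, ?_⟩
  · intro t ht t' ht' htt
    have h1 := hbanti t ht t' ht' htt
    have h2 := (hb t' ht').1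
    have h3 : 0 < 1 - t' := by linarith [ht'.2]
    simp only
    refine inv_strictAnti₀ (hpos' t' ht') ?_
    gcongr
  · exact fun t ht => inv_pos.mpr (hpos' t ht)
  · refine Tendsto.comp tendsto_inv_nhdsGT_zero ?_
    rw [tendsto_nhdsWithin_iff]
    refine ⟨?_, by filter_upwards [hIco] with t ht; exact hpos' t ht⟩
    have := (hid.const_sub 1).mul ((hb0.mono_right nhdsWithin_le_nhds).const_mul κ)
    simpa using this
  · have hη : ∀ θ, 0 < θ → Tendsto (fun t => η (κ * b t * θ) / (1 - t)) (𝓝[<] (1:ℝ)) (𝓝 ((1 + ρ) * θ ^ ρ)) := by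
      intro θ hθ
      have h1 := ((hrv (κ * θ) (by positivity)).comp hb0).div_const 2
      have h2 : (κ * θ) ^ ρ / 2 = (1 + ρ) * θ ^ ρ := by
        rw [Real.mul_rpow hκ0.le hθ.le, hκρ]; ring
      rw [h2] at h1
      refine h1.congr' ?_
      filter_upwards [hIco] with t ht
      simp only [Function.comp]
      rw [(hb t ht).2, show b t * (κ * θ) = κ * b t * θ by ring]
      have : (1 - t) ≠ 0 := by linarith [ht.2]
      generalize η (κ * b t * θ) = a
      field_simp
    have hη0 : ∀ θ, 0 < θ → Tendsto (fun t => η (κ * b t * θ)) (𝓝[<] (1:ℝ)) (𝓝 0) := by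
      intro θ hθ
      have h1 := (hη θ hθ).mul (hid.const_sub 1)
      simp only [sub_self, mul_zero] at h1
      refine h1.congr' ?_
      filter_upwards [hIco] with t ht
      have : (1 - t) ≠ 0 := by linarith [ht.2]
      field_simp
    have hg : ∀ θ, 0 < θ → Tendsto (fun t => ℒ t (κ * b t * θ - t * ψ (κ * b t * θ))) (𝓝[<] (1:ℝ))
        (𝓝 (1 / (1 + (1 + ρ) * θ ^ ρ))) := by
      intro θ hθ
      have h1 := ((hη0 θ hθ).const_sub 1).div (((hid.mul (hη θ hθ)).const_add 1)) (by positivity)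
      rw [one_mul, sub_zero] at h1
      refine h1.congr' ?_
      filter_upwards [hIco] with t ht
      have hbt := (hb t ht).1
      rw [hℒ t ht _ (by positivity)]
      have h3 : 0 < 1 - t := by linarith [ht.2]
      have h4 := hpos (κ * b t * θ) (by positivity)
      have h5 := ht.1
      simp only [Pi.div_apply]
      generalize η (κ * b t * θ) = a at *
      have : 0 < 1 - t + t * a := by positivity
      have : 0 < 1 + t * (a / (1 - t)) := by positivity
      field_simp
    have hQ : ∀ θ, 0 < θ → Tendsto (fun t => (κ * b t * θ - t * ψ (κ * b t * θ)) / ((1 - t) * (κ * b t))) (𝓝[<] (1:ℝ))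
        (𝓝 (θ + θ ^ (1 + ρ))) := by
      intro θ hθ
      have h1 := (I_scaling η hmono hcont h0 ρ hρ hrv (κ * θ) (by positivity)).comp hb0
      have h2 := (hid.mul (h1.div_const (2 * κ))).const_add θ
      have h3 : 1 * ((κ * θ) ^ (1 + ρ) / (1 + ρ) / (2 * κ)) = θ ^ (1 + ρ) := by
        rw [Real.mul_rpow hκ0.le hθ.le, Real.rpow_add hκ0, hκρ, Real.rpow_one]; field_simp
      rw [h3] at h2
      refine h2.congr' ?_
      filter_upwards [hIco] with t ht
      have hbt := (hb t ht).1
      have h3 : 0 < 1 - t := by linarith [ht.2]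
      rw [hψ _ (by positivity)]
      simp only [Function.comp]
      rw [(hb t ht).2, show b t * (κ * θ) = κ * b t * θ by ring]
      generalize (∫ u in (0:ℝ)..(κ * b t * θ), η u) = a
      have := h3.ne'
      field_simp
      ring
    intro θ hθ
    have hQmono : ∀ x y : ℝ, 0 < x → x < y → x + x ^ (1 + ρ) < y + y ^ (1 + ρ) := by
      intro x y hx hxy
      have := Real.rpow_lt_rpow hx.le hxy (by linarith : 0 < 1 + ρ)
      linarith
    have hgc : ContinuousAt (fun θ : ℝ => 1 / (1 + (1 + ρ) * θ ^ ρ)) θ := by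
      have : ContinuousAt (fun θ : ℝ => θ ^ ρ) θ := Real.continuousAt_rpow_const _ _ (Or.inl hθ.ne')
      refine ContinuousAt.div (by fun_prop) (by fun_prop) (by positivity)
    rw [tendsto_order]
    constructor
    · intro a ha
      have e1 := (hgc.eventually (lt_mem_nhds ha)).filter_mono (nhdsWithin_le_nhds (s := Ioi θ))
      obtain ⟨θ2, h1, h2⟩ := (e1.and self_mem_nhdsWithin).exists
      have h2 : θ < θ2 := h2
      have hθ2 : 0 < θ2 := hθ.trans h2
      filter_upwards [hIco, (hg θ2 hθ2).eventually_const_lt h1, (hQ θ2 hθ2).eventually_const_lt (hQmono θ θ2 hθ h2)] with t ht h4 h5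
      refine lt_of_lt_of_le h4 (hanti t ht ?_ ?_ ?_)
      · have := hpos' t ht
        rw [mem_Ioi]
        positivity
      · have := hpos' t ht
        rw [mem_Ioi]
        rw [lt_div_iff₀ this] at h5
        refine lt_trans ?_ h5
        positivity
      · have := hpos' t ht
        rw [lt_div_iff₀ this] at h5
        rw [div_inv_eq_mul]
        exact h5.le
    · intro a ha
      have e1 := (hgc.eventually (gt_mem_nhds ha)).filter_mono (nhdsWithin_le_nhds (s := Iio θ))
      have e2 := (lt_mem_nhds hθ).filter_mono (nhdsWithin_le_nhds (s := Iio θ))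
      obtain ⟨θ1, ⟨h1, hθ1⟩, h2⟩ := ((e1.and e2).and self_mem_nhdsWithin).exists
      have h2 : θ1 < θ := h2
      filter_upwards [hIco, (hg θ1 hθ1).eventually_lt_const h1, (hQ θ1 hθ1).eventually_lt_const (hQmono θ1 θ hθ1 h2), (hQ θ1 hθ1).eventually_const_lt (by positivity : 0 < θ1 + θ1 ^ (1 + ρ))] with t ht h4 h5 h6
      refine lt_of_le_of_lt (hanti t ht ?_ ?_ ?_) h4
      · have := hpos' t ht
        rw [mem_Ioi]
        rw [lt_div_iff₀ this, zero_mul] at h6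
        exact h6
      · have := hpos' t ht
        rw [mem_Ioi]
        positivity
      · have := hpos' t ht
        rw [div_lt_iff₀ this] at h5
        rw [div_inv_eq_mul]
        exact h5.le

lemma V_facts (μ : Measure ℝ) (hμ : μ (Iic 0) = 0) (t : ℝ) (ht : t ∈ Ico (0:ℝ) 1)
    (hi : Integrable (fun x : ℝ => x ^ 2) μ) (hv : ∫ x, x ^ 2 ∂μ = (1 - t)⁻¹) (V : ℝ → ℝ)
    (hV : ∀ x, V x = (∫ y in Ioc (0:ℝ) x, y ^ 2 ∂μ) / (∫ y in Ioi (0:ℝ), y ^ 2 ∂μ)) :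
    Monotone V ∧ (∀ x, 0 ≤ V x ∧ V x ≤ 1) ∧ V 0 = 0 ∧ ∀ q l : ℝ, 0 < q → 0 < l →
      ∫ x in Ioi (0:ℝ), Real.exp (-(q * x)) * V (l * x) = q⁻¹ * ((1 - t) * ∫ x, Real.exp (-((q / l) * x)) * x ^ 2 ∂μ) := by
  have h1t : 0 < 1 - t := by linarith [ht.2]
  have hae := ae_pos_of_Iic μ hμ
  set m : Measure ℝ := μ.withDensity (fun x => ENNReal.ofReal (x ^ 2)) with hm
  have hm0 : m (Iic 0) = 0 := by
    exact (withDensity_absolutelyContinuous μ _) hμ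
  have hmu : m univ = ENNReal.ofReal ((1 - t)⁻¹) := by
    rw [hm, withDensity_apply _ MeasurableSet.univ, Measure.restrict_univ, ← hv, ofReal_integral_eq_lintegral_ofReal hi (ae_of_all _ fun x => by positivity)]
  have : IsFiniteMeasure m := ⟨by rw [hmu]; exact ENNReal.ofReal_lt_top⟩
  have hmur : m.real univ = (1 - t)⁻¹ := by
    rw [measureReal_def, hmu, ENNReal.toReal_ofReal (by positivity)]
  have hIoi : ∫ y in Ioi (0:ℝ), y ^ 2 ∂μ = (1 - t)⁻¹ := by
    have h1 : (Ioi (0:ℝ)) =ᵐ[μ] univ := by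
      rw [eventuallyEq_univ]
      exact hae
    rw [← hv, setIntegral_congr_set h1, setIntegral_univ]
  have hVm : ∀ x, V x = (1 - t) * m.real (Iic x) := by
    intro x
    rw [hV, hIoi, div_inv_eq_mul, mul_comm]
    congr 1
    have h1 : (Iic x : Set ℝ) =ᵐ[μ] Ioc 0 x := by
      filter_upwards [hae] with y hy
      have : (y ∈ Iic x) = (y ∈ Ioc 0 x) := by simp [hy]
      exact this
    rw [measureReal_def, hm, withDensity_apply _ measurableSet_Iic, setLIntegral_congr h1,
      integral_eq_lintegral_of_nonneg_ae (ae_of_all _ fun x => by positivity) (by fun_prop)]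
  refine ⟨?_, ?_, ?_, ?_⟩
  · intro a b hab
    rw [hVm, hVm]
    have := measureReal_mono (μ := m) (Iic_subset_Iic.mpr hab)
    gcongr
  · intro x
    rw [hVm]
    refine ⟨by positivity, ?_⟩
    have := measureReal_mono (μ := m) (subset_univ (Iic x))
    rw [hmur] at this
    calc (1 - t) * m.real (Iic x) ≤ (1 - t) * (1 - t)⁻¹ := by gcongr
      _ = 1 := mul_inv_cancel₀ h1t.ne'
  · rw [hVm, measureReal_def, hm0]; simp
  · intro q l hq hl
    have h1 := integral_comp_mul_left_Ioi (fun y => Real.exp (-((q / l) * y)) * V y) 0 hl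
    simp only [mul_zero, smul_eq_mul] at h1
    have h2 : ∀ x, q / l * (l * x) = q * x := fun x => by field_simp
    simp_rw [h2] at h1
    rw [h1]
    have h3 : ∀ y, Real.exp (-((q / l) * y)) * V y = (1 - t) * (Real.exp (-((q / l) * y)) * m.real (Iic y)) := by
      intro y; rw [hVm]; ring
    simp_rw [h3]
    rw [integral_const_mul, lap_layer m hm0 (q / l) (by positivity)]
    have h4 : ∫ x, Real.exp (-((q / l) * x)) ∂m = ∫ x, Real.exp (-((q / l) * x)) * x ^ 2 ∂μ := by
      rw [hm, integral_withDensity_eq_integral_toReal_smul (by fun_prop) (ae_of_all _ fun x => ENNReal.ofReal_lt_top)]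
      refine integral_congr_ae (ae_of_all _ fun x => ?_)
      simp only [smul_eq_mul]
      rw [ENNReal.toReal_ofReal (by positivity)]; ring
    rw [h4]
    generalize (∫ x, Real.exp (-((q / l) * x)) * x ^ 2 ∂μ) = a
    field_simp

lemma U_rv (U L : ℝ → ℝ) (ρ : ℝ)
    (hLpos : ∀ x : ℝ, 0 < x → 0 < L x)
    (hLslow : ∀ c : ℝ, 0 < c → Tendsto (fun x => L (c * x) / L x) atTop (𝓝 1))
    (htail : Tendsto (fun x => U x / (x ^ (1 - ρ) * L x)) atTop (𝓝 1)) :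
    (∀ᶠ x in atTop, 0 < U x) ∧
    ∀ c : ℝ, 0 < c → Tendsto (fun x => U (c * x) / U x) atTop (𝓝 (c ^ (1 - ρ))) := by
  have hpos : ∀ᶠ x in atTop, 0 < U x := by
    filter_upwards [htail.eventually_const_lt one_pos, eventually_gt_atTop 0] with x h1 hx
    have hL := hLpos x hx
    have : 0 < x ^ (1 - ρ) * L x := by positivity
    exact (div_pos_iff_of_pos_right this).mp h1
  refine ⟨hpos, fun c hc => ?_⟩
  have hcx : Tendsto (fun x : ℝ => c * x) atTop atTop := tendsto_id.const_mul_atTop hc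
  have h1 := (((htail.comp hcx).div htail one_ne_zero).mul (hLslow c hc)).mul_const (c ^ (1 - ρ))
  rw [div_one, one_mul, one_mul] at h1
  refine h1.congr' ?_
  filter_upwards [hpos, eventually_gt_atTop 0] with x hU hx
  have hL := hLpos x hx
  have hL' := hLpos (c * x) (by positivity)
  simp only [Pi.div_apply, Function.comp]
  rw [Real.mul_rpow hc.le hx.le]
  generalize U (c * x) = a at *
  generalize L (c * x) = d at *
  have h2 : 0 < c ^ (1 - ρ) := by positivity
  have h3 : 0 < x ^ (1 - ρ) := by positivity
  field_simp

theorem multiplicative_kernel_scaling_sufficiency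
    -- ν₀ : positive measure on (0,∞) with second moment ∫ x² ν₀(dx) = 1
    (ν₀ : Measure ℝ) (hν₀supp : ν₀ (Set.Iic 0) = 0)
    (hmom : ∫⁻ x, ENNReal.ofReal (x ^ 2) ∂ν₀ = 1)
    -- desingularized Laplace transform ψ₀(s) = ∫ (1−e^{−sx}) x ν₀(dx)
    (ψ₀ : ℝ → ℝ) (hψ₀ : ∀ s : ℝ, ψ₀ s = ∫ x, (1 - Real.exp (-(s * x))) * x ∂ν₀)
    -- characteristic map: σ(τ,s) > 0 solves s = σ − (1 − e^{−τ}) ψ₀(σ)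
    (σ : ℝ → ℝ → ℝ)
    (hσ : ∀ τ : ℝ, 0 ≤ τ → ∀ s : ℝ, 0 < s →
      0 < σ τ s ∧ s = σ τ s - (1 - Real.exp (-τ)) * ψ₀ (σ τ s))
    -- (ν t), 0 ≤ t < 1 is the solution:
    -- ∫ (1−e^{−sx}) x ν_t(dx) = (1−t)⁻¹ e^{−τ} ψ₀(σ(τ,s)) with τ = −log(1−t)
    (ν : ℝ → Measure ℝ)
    (hsol : ∀ t : ℝ, t ∈ Set.Ico (0:ℝ) 1 → (ν t) (Set.Iic 0) = 0 ∧
      ∀ s : ℝ, 0 < s →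
        ∫ x, (1 - Real.exp (-(s * x))) * x ∂(ν t) =
          (1 - t)⁻¹ * (Real.exp (-(-Real.log (1 - t))) *
            ψ₀ (σ (-Real.log (1 - t)) s)))
    -- second-moment distribution function V(t,x)
    (V : ℝ → ℝ → ℝ)
    (hV : ∀ t : ℝ, t ∈ Set.Ico (0:ℝ) 1 → ∀ x : ℝ,
      V t x = (∫ y in Set.Ioc (0:ℝ) x, y ^ 2 ∂(ν t)) /
        (∫ y in Set.Ioi (0:ℝ), y ^ 2 ∂(ν t)))
    -- hypothesis: ∫₀^x y³ ν₀(dy) ~ x^{1-ρ} L(x) as x → ∞ with ρ ∈ (0,1], L slowly varying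
    (ρ : ℝ) (hρ : ρ ∈ Set.Ioc (0:ℝ) 1)
    (L : ℝ → ℝ)
    (hLpos : ∀ x : ℝ, 0 < x → 0 < L x)
    (hLslow : ∀ c : ℝ, 0 < c → Tendsto (fun x => L (c * x) / L x) atTop (𝓝 1))
    (htail : Tendsto (fun x => (∫ y in Set.Ioc (0:ℝ) x, y ^ 3 ∂ν₀) / (x ^ (1 - ρ) * L x))
      atTop (𝓝 1)) :
    -- conclusion: strictly increasing rescaling λ(t) → ∞ as t → 1⁻, with
    -- V(t, λ(t) x) → V_ρ(x) for all x ∈ [0,∞)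
    ∃ lam : ℝ → ℝ, StrictMonoOn lam (Set.Ico 0 1) ∧ Tendsto lam (𝓝[<] (1:ℝ)) atTop ∧
      ∀ x : ℝ, 0 ≤ x →
        Tendsto (fun t => V t (lam t * x)) (𝓝[<] (1:ℝ))
          (𝓝 (multSelfSimilarCDF ρ x)) := by
  obtain ⟨hρ0, hρ1⟩ := hρ
  set F : Measure ℝ := ν₀.withDensity (fun x => ENNReal.ofReal (x ^ 2)) with hFdef
  set η : ℝ → ℝ := fun s => ∫ x, (1 - Real.exp (-(s * x))) ∂F with hη
  obtain ⟨hP, hF0, hder, hle, hpos, hI⟩ := psi_facts ν₀ hν₀supp hmom ψ₀ hψ₀ F hFdef η (fun s => rfl)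
  obtain ⟨h0, hm, hc, htop⟩ := eta_facts F hF0 η (fun s => rfl)
  have hU : ∀ x, ∫ y in Ioc (0:ℝ) x, y ∂F = ∫ y in Ioc (0:ℝ) x, y ^ 3 ∂ν₀ := by
    intro x
    rw [hFdef, setIntegral_withDensity_eq_setIntegral_toReal_smul (by fun_prop)
      (ae_of_all _ fun x => ENNReal.ofReal_lt_top) _ measurableSet_Ioc]
    refine integral_congr_ae (ae_of_all _ fun y => ?_)
    simp only [smul_eq_mul]
    rw [ENNReal.toReal_ofReal (by positivity)]; ring
  obtain ⟨hUpos, hUrv⟩ := U_rv (fun x => ∫ y in Ioc (0:ℝ) x, y ∂F) L ρ hLpos hLslow (by simp_rw [hU]; exact htail)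
  have hrv : ∀ θ, 0 < θ → Tendsto (fun b => η (b * θ) / η b) (𝓝[>] 0) (𝓝 (θ ^ ρ)) := by
    intro θ hθ
    have := eta_rv F hF0 (1 - ρ) (by linarith) (by linarith) hUpos hUrv θ hθ
    rw [sub_sub_cancel] at this
    exact this
  have hsolF : ∀ t ∈ Ico (0:ℝ) 1, Integrable (fun x : ℝ => x ^ 2) (ν t) ∧ ∫ x, x ^ 2 ∂(ν t) = (1 - t)⁻¹ ∧
      ∀ θ, 0 < θ → ∫ x, Real.exp (-((θ - t * ψ₀ θ) * x)) * x ^ 2 ∂(ν t) = (1 - η θ) / ((1 - t) + t * η θ) := by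
    intro t ht
    have h1t : 0 < 1 - t := by linarith [ht.2]
    have hexp : Real.exp (-(-Real.log (1 - t))) = 1 - t := by rw [neg_neg, Real.exp_log h1t]
    have hτ : 0 ≤ -Real.log (1 - t) := by
      have := Real.log_nonpos h1t.le (by linarith [ht.1]); linarith
    refine sol_facts (ν t) (hsol t ht).1 t ht ψ₀ η hder hle hpos h0 hm hc (σ (-Real.log (1 - t))) ?_ ?_
    · intro s hs
      have := hσ _ hτ s hs
      rw [hexp, sub_sub_cancel] at this
      exact this
    · intro s hs
      rw [(hsol t ht).2 s hs, hexp, ← mul_assoc, inv_mul_cancel₀ h1t.ne', one_mul]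
  have hVF := fun t ht => V_facts (ν t) (hsol t ht).1 t ht (hsolF t ht).1 (hsolF t ht).2.1 (V t) (hV t ht)
  obtain ⟨lam, hlmono, hlpos, hltop, hlim⟩ := scaling η hm hc h0 htop ρ hρ0 hrv ψ₀ hI
    (fun t s => (1 - t) * ∫ x, Real.exp (-(s * x)) * x ^ 2 ∂(ν t)) (by
      intro t ht a ha b hb hab
      have h1t : 0 < 1 - t := by linarith [ht.2]
      have hae := ae_pos_of_Iic (ν t) (hsol t ht).1
      have hint : ∀ s : ℝ, 0 < s → Integrable (fun x => Real.exp (-(s * x)) * x ^ 2) (ν t) := by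
        intro s hs
        refine (hsolF t ht).1.mono' (by fun_prop) ?_
        filter_upwards [hae] with x hx
        rw [Real.norm_eq_abs, abs_of_nonneg (by positivity)]
        have : Real.exp (-(s * x)) ≤ 1 := by
          rw [Real.exp_le_one_iff]; have := mul_pos hs hx; linarith
        exact mul_le_of_le_one_left (by positivity) this
      refine mul_le_mul_of_nonneg_left ?_ h1t.le
      refine integral_mono_ae (hint b hb) (hint a ha) ?_
      filter_upwards [hae] with x hx
      gcongr) (by
      intro t ht θ hθ
      rw [(hsolF t ht).2.2 θ hθ, mul_div_assoc])
  refine ⟨lam, hlmono, hltop, ?_⟩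
  have hIco : ∀ᶠ t in 𝓝[<] (1:ℝ), t ∈ Ico (0:ℝ) 1 := by
    filter_upwards [self_mem_nhdsWithin, nhdsWithin_le_nhds (Ici_mem_nhds (by norm_num : (0:ℝ) < 1))] with t h1 h2
    exact ⟨h2, h1⟩
  intro x hx
  rcases eq_or_lt_of_le hx with hx0 | hx0
  · subst hx0
    have hz : multSelfSimilarCDF ρ 0 = 0 := by
      unfold multSelfSimilarCDF
      convert! tsum_zero with k
      rw [Real.zero_rpow (by positivity)]; simp
    rw [hz]
    refine tendsto_const_nhds.congr' ?_
    filter_upwards [hIco] with t ht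
    rw [mul_zero, (hVF t ht).2.2.1]
  · set θ0 : ℝ := (8:ℝ) ^ (1 / ρ) with hθ0
    have hθ0p : 0 < θ0 := by positivity
    have hθ0v : θ0 ^ (-ρ) = 1 / 8 := by
      rw [hθ0, ← Real.rpow_mul (by norm_num)]
      have : 1 / ρ * -ρ = -1 := by field_simp
      rw [this, Real.rpow_neg_one]; norm_num
    obtain ⟨N, hN⟩ := exists_nat_ge (θ0 + θ0 ^ (1 + ρ))
    have hex : ∀ n : ℕ, N ≤ n → ∃ θ : ℝ, 0 < θ ∧ θ ^ (-ρ) ≤ 1 / 8 ∧ θ + θ ^ (1 + ρ) = n := by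
      intro n hn
      have hn' : (N:ℝ) ≤ n := by exact_mod_cast hn
      have hc1 : ContinuousOn (fun θ : ℝ => θ + θ ^ (1 + ρ)) (Icc θ0 n) := by
        refine continuousOn_id.add (continuousOn_id.rpow_const fun x _ => Or.inr (by linarith))
      have hle0 : θ0 ≤ n := by
        have : 0 < θ0 ^ (1 + ρ) := by positivity
        linarith
      obtain ⟨θ, h1, h2⟩ := intermediate_value_Icc hle0 hc1 (show (n:ℝ) ∈ Icc _ _ from ⟨by linarith, by
        have : (0:ℝ) ≤ (n:ℝ) ^ (1 + ρ) := by positivity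
        linarith⟩)
      refine ⟨θ, lt_of_lt_of_le hθ0p h1.1, ?_, h2⟩
      rw [← hθ0v]
      exact Real.rpow_le_rpow_of_nonpos hθ0p h1.1 (by linarith)
    have hN1 : 1 ≤ N := by
      have : (0:ℝ) < N := lt_of_lt_of_le (by positivity) hN
      exact_mod_cast this
    refine laplace_cont (fun t x => V t (lam t * x)) (multSelfSimilarCDF ρ) N hN1 ?_ (cdf_continuousOn ρ hρ0) ?_ ?_ x hx0
    · filter_upwards [hIco] with t ht
      have h1 := hVF t ht
      have h2 := hlpos t ht
      refine ⟨fun a b hab => h1.1 ?_, fun x => h1.2.1 _⟩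
      gcongr
    · intro n hn
      obtain ⟨θ, h1, h2, h3⟩ := hex n hn
      have h4 := cdf_laplace ρ hρ0 θ h1 h2
      rw [h3] at h4
      refine Integrable.of_integral_ne_zero ?_
      rw [h4, ← h3]
      positivity
    · intro n hn
      obtain ⟨θ, h1, h2, h3⟩ := hex n hn
      have h4 := cdf_laplace ρ hρ0 θ h1 h2
      rw [h3] at h4
      rw [h4]
      have hn0 : (0:ℝ) < n := by rw [← h3]; positivity
      have h5 := (hlim θ h1).const_mul (n:ℝ)⁻¹
      rw [h3] at h5
      refine h5.congr' ?_
      filter_upwards [hIco] with t ht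
      exact ((hVF t ht).2.2.2 n (lam t) hn0 (hlpos t ht)).symm
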